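/- arXiv:1201.0690 — 2 statements merged into one kernel-verified Lean document; each statement's English description precedes it below -/
import Mathlib

section
/- Rellich identity: every homogeneous radiating solution H satisfies ∫_Ω [ 2 ε_r⁻¹ |∂H/∂x₃|² − x₃ (∂ε_r⁻¹/∂x₃) |curl_α H|² + 2 Re( (∇ε_r⁻¹ · ∂H/∂x₃) conj(H₃) ) ] dx + Re ∫_{Γ_h} (e₃×(R_α×H)) · conj(H) ds − 2 Re ∫_{Γ_h} T_α(H₃) conj(H₃) ds = 0. -/
open MeasureTheory Real

noncomputable section

abbrev R3 : Type := Fin 3 → ℝ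
abbrev C3 : Type := Fin 3 → ℂ

/-- Partial derivative of a complex-valued function on `ℝ³`. -/
def pdC (i : Fin 3) (f : R3 → ℂ) (x : R3) : ℂ := fderiv ℝ f x (Pi.single i 1)

/-- Partial derivative of a real-valued function on `ℝ³`. -/
def pdR (i : Fin 3) (f : R3 → ℝ) (x : R3) : ℝ := fderiv ℝ f x (Pi.single i 1)

/-- The shifted partial derivative `∂^α f/∂x_i = ∂f/∂x_i + i α_i f`. -/
def pdA (α : R3) (i : Fin 3) (f : R3 → ℂ) (x : R3) : ℂ :=
  pdC i f x + Complex.I * (α i : ℂ) * f x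

/-- Componentwise partial derivative of a vector field. -/
def pdV (i : Fin 3) (F : R3 → C3) (x : R3) : C3 := fun j => pdC i (fun y => F y j) x

def realToC3 (a : R3) : C3 := fun i => (a i : ℂ)

/-- Cross product of complex 3-vectors. -/
def crossC (a b : C3) : C3 :=
  ![a 1 * b 2 - a 2 * b 1, a 2 * b 0 - a 0 * b 2, a 0 * b 1 - a 1 * b 0]

/-- Cross product of real 3-vectors. -/
def crossR (a b : R3) : R3 :=
  ![a 1 * b 2 - a 2 * b 1, a 2 * b 0 - a 0 * b 2, a 0 * b 1 - a 1 * b 0]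

/-- The unit vector `e₃ = (0,0,1)` as a complex vector. -/
def e3 : C3 := ![0, 0, 1]

/-- `ã = (a₁,a₂,−a₃)`. -/
def tld (a : R3) : R3 := ![a 0, a 1, -(a 2)]

/-- The curl of a complex vector field on `ℝ³`. -/
def curlF (F : R3 → C3) (x : R3) : C3 :=
  ![pdC 1 (fun y => F y 2) x - pdC 2 (fun y => F y 1) x,
    pdC 2 (fun y => F y 0) x - pdC 0 (fun y => F y 2) x,
    pdC 0 (fun y => F y 1) x - pdC 1 (fun y => F y 0) x]

/-- `curl_α F = curl F + i α × F`. -/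
def curlA (α : R3) (F : R3 → C3) (x : R3) : C3 :=
  curlF F x + Complex.I • crossC (realToC3 α) (F x)

/-- The divergence of a complex vector field. -/
def divFld (F : R3 → C3) (x : R3) : ℂ := ∑ i, pdC i (fun y => F y i) x

/-- `div_α F = div F + i α · F`. -/
def divA (α : R3) (F : R3 → C3) (x : R3) : ℂ :=
  divFld F x + Complex.I * ∑ i, (α i : ℂ) * F x i

/-- Squared Euclidean norm of a complex 3-vector. -/
def nsq (v : C3) : ℝ := ∑ i, Complex.normSq (v i)

/-- `a · conj b` for complex 3-vectors. -/
def dotc (a b : C3) : ℂ := ∑ i, a i * (starRingEnd ℂ) (b i)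

/-- Plain (bilinear) dot product of complex 3-vectors. -/
def dotp (a b : C3) : ℂ := ∑ i, a i * b i

/-- Componentwise complex conjugate of a vector. -/
def conjV (v : C3) : C3 := fun i => (starRingEnd ℂ) (v i)

/-- Transverse part `(v₁, v₂, 0)` of a vector. -/
def vecT (v : C3) : C3 := ![v 0, v 1, 0]

/-- The periodicity cell `Ω = (0,2π)² × (0,h)`. -/
def Omg (h : ℝ) : Set R3 :=
  {x | x 0 ∈ Set.Ioo 0 (2 * π) ∧ x 1 ∈ Set.Ioo 0 (2 * π) ∧ x 2 ∈ Set.Ioo 0 h}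

/-- The square `(0,2π)²` parametrizing the horizontal boundary faces. -/
def sq2 : Set (ℝ × ℝ) := Set.Ioo 0 (2 * π) ×ˢ Set.Ioo 0 (2 * π)

/-- The point `(p₁, p₂, t) ∈ ℝ³`. -/
def bpt (p : ℝ × ℝ) (t : ℝ) : R3 := ![p.1, p.2, t]

/-- `2π`-periodicity in the first two variables. -/
def Biperiodic {E : Type*} (f : R3 → E) : Prop :=
  ∀ x : R3, f (x + (2 * π) • (Pi.single 0 1 : R3)) = f x ∧ f (x + (2 * π) • (Pi.single 1 1 : R3)) = f x

/-- Fourier coefficient of order `n ∈ ℤ²` of `H(·,·,t)` on the square `(0,2π)²`. -/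
def fcoeff (H : R3 → C3) (n : ℤ × ℤ) (t : ℝ) : C3 := fun j =>
  (1 / (4 * (π : ℂ) ^ 2)) *
    ∫ p in sq2, H (bpt p t) j *
      Complex.exp (-Complex.I * (((n.1 : ℝ) * p.1 + (n.2 : ℝ) * p.2 : ℝ) : ℂ))

/-- `β_n = √(k²−|n+α|²)` if `k² ≥ |n+α|²`, and `i √(|n+α|²−k²)` otherwise. -/
def betaN (k : ℝ) (α : R3) (n : ℤ × ℤ) : ℂ :=
  if ((n.1 : ℝ) + α 0) ^ 2 + ((n.2 : ℝ) + α 1) ^ 2 ≤ k ^ 2 then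
    ((Real.sqrt (k ^ 2 - (((n.1 : ℝ) + α 0) ^ 2 + ((n.2 : ℝ) + α 1) ^ 2)) : ℝ) : ℂ)
  else
    Complex.I * ((Real.sqrt ((((n.1 : ℝ) + α 0) ^ 2 + ((n.2 : ℝ) + α 1) ^ 2) - k ^ 2) : ℝ) : ℂ)

/-- The exterior Dirichlet-to-Neumann operator `T_α` applied to the `j`-th component of
the trace of `H` on `Γ_h`, evaluated at the boundary point `(p₁,p₂,h)`. -/
def Talpha (k : ℝ) (α : R3) (H : R3 → C3) (h : ℝ) (j : Fin 3) (p : ℝ × ℝ) : ℂ :=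
  ∑' n : ℤ × ℤ, Complex.I * betaN k α n * fcoeff H n h j *
    Complex.exp (Complex.I * (((n.1 : ℝ) * p.1 + (n.2 : ℝ) * p.2 : ℝ) : ℂ))

/-- Standing hypotheses on `ε_r⁻¹`: `C¹`, biperiodic, positive and bounded away from
zero, and equal to `1` near `Γ_h`. -/
structure EpsOK (h : ℝ) (εinv : R3 → ℝ) : Prop where
  smooth : ContDiff ℝ 1 εinv
  periodic : Biperiodic εinv
  pos : ∃ c : ℝ, 0 < c ∧ ∀ x, c ≤ εinv x
  one_near_top : ∃ η : ℝ, 0 < η ∧ η < h ∧ ∀ x : R3, h - η < x 2 → εinv x = 1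

/-- A homogeneous radiating solution of the biperiodic scattering problem. -/
structure IsHomSol (h k : ℝ) (α : R3) (εinv : R3 → ℝ) (H : R3 → C3) : Prop where
  smooth : ContDiff ℝ 2 H
  periodic : Biperiodic H
  maxwell : ∀ x ∈ Omg h, curlA α (fun y => (εinv y : ℂ) • curlA α H y) x = (k ^ 2 : ℂ) • H x
  divfree : ∀ x ∈ Omg h, divA α H x = 0
  bc_normal : ∀ x : R3, x 2 = 0 → H x 2 = 0
  bc_tangential : ∀ x : R3, x 2 = 0 → crossC e3 ((εinv x : ℂ) • curlA α H x) = 0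
  radiation : ∀ n : ℤ × ℤ, ∀ j : Fin 3,
    deriv (fun t => fcoeff H n t j) h = Complex.I * betaN k α n * fcoeff H n h j

/-- The non-trapping assumptions (a), (b), (c) on `ε_r⁻¹`. -/
def NonTrapping (h : ℝ) (εinv : R3 → ℝ) : Prop :=
  (∀ x ∈ Omg h, pdR 2 εinv x ≤ 0) ∧
  (∃ U : Set R3, IsOpen U ∧ U.Nonempty ∧ U ⊆ Omg h ∧ ∀ x ∈ U, pdR 2 εinv x < 0) ∧
  (∃ δ : ℝ, 1 / 2 < δ ∧ ∃ Mt Mz : ℝ,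
    (∀ x ∈ Omg h, (pdR 0 εinv x) ^ 2 + (pdR 1 εinv x) ^ 2 ≤ Mt ^ 2) ∧
    (∀ x ∈ Omg h, |pdR 2 εinv x| ≤ Mz) ∧
    δ / 2 * Mt ^ 2 + Real.sqrt 2 / h * Mz < 2 / h ^ 2)

theorem pdC_mul {i : Fin 3} {f g : R3 → ℂ} {x : R3} (hf : DifferentiableAt ℝ f x)
    (hg : DifferentiableAt ℝ g x) :
    pdC i (fun y => f y * g y) x = pdC i f x * g x + f x * pdC i g x := by
  simp only [pdC]
  rw [fderiv_fun_mul hf hg]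
  simp
  ring

theorem pdC_add {i : Fin 3} {f g : R3 → ℂ} {x : R3} (hf : DifferentiableAt ℝ f x)
    (hg : DifferentiableAt ℝ g x) :
    pdC i (fun y => f y + g y) x = pdC i f x + pdC i g x := by
  simp only [pdC]
  rw [fderiv_fun_add hf hg]
  simp

theorem pdC_sub {i : Fin 3} {f g : R3 → ℂ} {x : R3} (hf : DifferentiableAt ℝ f x)
    (hg : DifferentiableAt ℝ g x) :
    pdC i (fun y => f y - g y) x = pdC i f x - pdC i g x := by
  simp only [pdC]
  rw [fderiv_fun_sub hf hg]
  simp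

theorem pdC_conj {i : Fin 3} {f : R3 → ℂ} {x : R3} (hf : DifferentiableAt ℝ f x) :
    pdC i (fun y => (starRingEnd ℂ) (f y)) x = (starRingEnd ℂ) (pdC i f x) := by
  have h := (Complex.conjCLE.toContinuousLinearMap.hasFDerivAt (x := f x)).comp x hf.hasFDerivAt
  have h' : HasFDerivAt (fun y => (starRingEnd ℂ) (f y)) _ x := h
  simp only [pdC]
  rw [h'.fderiv]
  simp

theorem pdC_ofReal {i : Fin 3} {r : R3 → ℝ} {x : R3} (hr : DifferentiableAt ℝ r x) :
    pdC i (fun y => (r y : ℂ)) x = (pdR i r x : ℂ) := by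
  have h := (Complex.ofRealCLM.hasFDerivAt (x := r x)).comp x hr.hasFDerivAt
  have h' : HasFDerivAt (fun y => (r y : ℂ)) _ x := h
  simp only [pdC, pdR]
  rw [h'.fderiv]
  simp

theorem pdC_const {i : Fin 3} {c : ℂ} {x : R3} : pdC i (fun _ => c) x = 0 := by
  simp [pdC]

theorem pdR_coord {i j : Fin 3} {x : R3} :
    pdR i (fun y => y j) x = if i = j then 1 else 0 := by
  have h : HasFDerivAt (fun y : R3 => y j) (ContinuousLinearMap.proj (R := ℝ) j) x :=
    (ContinuousLinearMap.proj (R := ℝ) (φ := fun _ : Fin 3 => ℝ) j).hasFDerivAt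
  simp only [pdR]
  rw [h.fderiv]
  simp [Pi.single_apply, eq_comm]

theorem contDiff_pdC {m : ℕ} {i : Fin 3} {f : R3 → ℂ} (hf : ContDiff ℝ (m + 1) f) :
    ContDiff ℝ m (pdC i f) := by
  unfold pdC
  exact (hf.fderiv_right le_rfl).clm_apply contDiff_const

theorem continuous_pdC {i : Fin 3} {f : R3 → ℂ} (hf : ContDiff ℝ 1 f) : Continuous (pdC i f) :=
  (contDiff_pdC (m := 0) (by simpa using hf)).continuous

theorem contDiff_one_pdC {i : Fin 3} {f : R3 → ℂ} (hf : ContDiff ℝ 2 f) :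
    ContDiff ℝ 1 (pdC i f) :=
  contDiff_pdC (m := 1) (by norm_num; exact hf)

theorem Biperiodic.pdC {i : Fin 3} {f : R3 → ℂ} (hf : Biperiodic f) : Biperiodic (pdC i f) := by
  intro x
  constructor
  · have h : (fun y => f (y + (2 * π) • (Pi.single 0 1 : R3))) = f := funext fun y => (hf y).1
    have h2 := fderiv_comp_add_right (𝕜 := ℝ) (f := f) (x := x) ((2 * π) • (Pi.single 0 1 : R3))
    rw [h] at h2
    simp only [_root_.pdC, h2]
  · have h : (fun y => f (y + (2 * π) • (Pi.single 1 1 : R3))) = f := funext fun y => (hf y).2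
    have h2 := fderiv_comp_add_right (𝕜 := ℝ) (f := f) (x := x) ((2 * π) • (Pi.single 1 1 : R3))
    rw [h] at h2
    simp only [_root_.pdC, h2]

theorem pdC_comm {i j : Fin 3} {f : R3 → ℂ} (hf : ContDiff ℝ 2 f) (x : R3) :
    pdC i (pdC j f) x = pdC j (pdC i f) x := by
  have hd : DifferentiableAt ℝ (fderiv ℝ f) x :=
    ((hf.fderiv_right (m := 1) (by norm_num)).differentiable (by norm_num)) x
  have key : ∀ u v : R3, fderiv ℝ (fun y => fderiv ℝ f y u) x v = fderiv ℝ (fderiv ℝ f) x v u := by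
    intro u v
    rw [fderiv_clm_apply hd (differentiableAt_const u)]
    simp
  have hs : IsSymmSndFDerivAt ℝ f x := hf.contDiffAt.isSymmSndFDerivAt (by simp)
  unfold pdC
  rw [key, key]
  exact hs _ _

theorem pdA_two {α : R3} (hα : α 2 = 0) (f : R3 → ℂ) : pdA α 2 f = pdC 2 f := by
  funext x
  simp [pdA, hα]

theorem pdC_two_pdA {α : R3} {i : Fin 3} {f : R3 → ℂ} (hf : ContDiff ℝ 2 f) (x : R3) :
    pdC 2 (pdA α i f) x = pdA α i (pdC 2 f) x := by
  have hd : DifferentiableAt ℝ f x := hf.differentiable (by norm_num) x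
  have hp : DifferentiableAt ℝ (pdC i f) x :=
    (contDiff_one_pdC hf).differentiable (by norm_num) x
  have h : pdC 2 (fun y => pdC i f y + Complex.I * (α i : ℂ) * f y) x = _ :=
    pdC_add hp (by fun_prop)
  change pdC 2 (fun y => pdC i f y + Complex.I * (α i : ℂ) * f y) x = _
  rw [h, pdC_mul (by fun_prop) hd, pdC_const, pdC_comm hf]
  simp [pdA]

theorem contDiff_pdA {α : R3} {i : Fin 3} {f : R3 → ℂ} (hf : ContDiff ℝ 2 f) :
    ContDiff ℝ 1 (pdA α i f) := by
  unfold pdA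
  exact (contDiff_one_pdC hf).add (contDiff_const.mul (hf.of_le (by norm_num)))

theorem Biperiodic.pdA {α : R3} {i : Fin 3} {f : R3 → ℂ} (hf : Biperiodic f) :
    Biperiodic (pdA α i f) := by
  intro x
  simp [_root_.pdA, (hf.pdC x).1, (hf.pdC x).2, (hf x).1, (hf x).2]

/-- The product rule for `f * conj g` in terms of shifted derivatives. -/
theorem pdC_mul_conj (α : R3) {i : Fin 3} {f g : R3 → ℂ} {x : R3} (hf : DifferentiableAt ℝ f x)
    (hg : DifferentiableAt ℝ g x) :
    pdC i (fun y => f y * (starRingEnd ℂ) (g y)) x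
      = pdA α i f x * (starRingEnd ℂ) (g x) + f x * (starRingEnd ℂ) (pdA α i g x) := by
  have hc : DifferentiableAt ℝ (fun y => (starRingEnd ℂ) (g y)) x :=
    (Complex.conjCLE.toContinuousLinearMap.differentiableAt).comp x hg
  rw [pdC_mul hf hc, pdC_conj hg]
  simp [pdA]
  ring

theorem pdA_ofReal_mul {α : R3} {i : Fin 3} {r : R3 → ℝ} {f : R3 → ℂ} {x : R3}
    (hr : DifferentiableAt ℝ r x) (hf : DifferentiableAt ℝ f x) :
    pdA α i (fun y => (r y : ℂ) * f y) x = (pdR i r x : ℂ) * f x + (r x : ℂ) * pdA α i f x := by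
  have hc : DifferentiableAt ℝ (fun y => (r y : ℂ)) x :=
    (Complex.ofRealCLM.differentiableAt).comp x hr
  simp only [pdA]
  rw [pdC_mul hc hf, pdC_ofReal hr]
  ring

theorem curlA_zero (α : R3) (F : R3 → C3) (x : R3) :
    curlA α F x 0 = pdA α 1 (fun y => F y 2) x - pdA α 2 (fun y => F y 1) x := by
  simp [curlA, curlF, crossC, pdA, realToC3]
  ring

theorem curlA_one (α : R3) (F : R3 → C3) (x : R3) :
    curlA α F x 1 = pdA α 2 (fun y => F y 0) x - pdA α 0 (fun y => F y 2) x := by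
  simp [curlA, curlF, crossC, pdA, realToC3]
  ring

theorem curlA_two (α : R3) (F : R3 → C3) (x : R3) :
    curlA α F x 2 = pdA α 0 (fun y => F y 1) x - pdA α 1 (fun y => F y 0) x := by
  simp [curlA, curlF, crossC, pdA, realToC3]
  ring

theorem divA_eq (α : R3) (F : R3 → C3) (x : R3) :
    divA α F x = pdA α 0 (fun y => F y 0) x + pdA α 1 (fun y => F y 1) x
      + pdA α 2 (fun y => F y 2) x := by
  simp [divA, divFld, pdA, Fin.sum_univ_three]
  ring

theorem continuous_bpt : Continuous fun q : (ℝ × ℝ) × ℝ => bpt q.1 q.2 := by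
  refine continuous_pi fun i => ?_
  fin_cases i <;> simp [bpt] <;> fun_prop

theorem isCompact_closedSquare :
    IsCompact (Set.Icc (0 : ℝ) (2 * π) ×ˢ Set.Icc (0 : ℝ) (2 * π)) :=
  isCompact_Icc.prod isCompact_Icc

theorem sq2_subset : sq2 ⊆ Set.Icc (0 : ℝ) (2 * π) ×ˢ Set.Icc (0 : ℝ) (2 * π) :=
  Set.prod_mono Set.Ioo_subset_Icc_self Set.Ioo_subset_Icc_self

theorem measurableSet_sq2 : MeasurableSet sq2 := measurableSet_Ioo.prod measurableSet_Ioo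

theorem volume_sq2_lt_top : volume sq2 < ⊤ :=
  (measure_mono sq2_subset).trans_lt isCompact_closedSquare.measure_lt_top

theorem integrableOn_sq2 {g : ℝ × ℝ → ℂ} (hg : Continuous g) : IntegrableOn g sq2 :=
  (hg.continuousOn.integrableOn_compact isCompact_closedSquare).mono_set sq2_subset

theorem setIntegral_sq2_eq {g : ℝ × ℝ → ℂ} (hg : Continuous g) :
    ∫ p in sq2, g p = ∫ x in (0)..(2 * π), ∫ y in (0)..(2 * π), g (x, y) := by
  have hp : (0 : ℝ) ≤ 2 * π := by positivity
  rw [sq2, Measure.volume_eq_prod, setIntegral_prod]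
  · simp only [intervalIntegral.integral_of_le hp, integral_Ioc_eq_integral_Ioo]
  · exact integrableOn_sq2 hg

theorem setIntegral_sq2_eq_swap {g : ℝ × ℝ → ℂ} (hg : Continuous g) :
    ∫ p in sq2, g p = ∫ y in (0)..(2 * π), ∫ x in (0)..(2 * π), g (x, y) := by
  have h := setIntegral_sq2_eq (g := fun p => g p.swap) (by fun_prop)
  simp only [Prod.swap_prod_mk] at h
  rw [← h, sq2, Measure.volume_eq_prod,
    setIntegral_prod_swap (Set.Ioo 0 (2 * π)) (Set.Ioo 0 (2 * π)) g]

theorem integral_Icc_fin_two {g : ℝ × ℝ → ℂ} {b : Fin 2 → ℝ} (hb : ∀ i, b i = 2 * π) :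
    ∫ z in Set.Icc (0 : Fin 2 → ℝ) b, g (z 0, z 1) = ∫ p in sq2, g p := by
  have h1 : (Set.pi Set.univ fun i : Fin 2 => Set.Ioo ((0 : Fin 2 → ℝ) i) (b i))
      =ᵐ[volume] Set.Icc (0 : Fin 2 → ℝ) b := Measure.univ_pi_Ioo_ae_eq_Icc
  rw [← setIntegral_congr_set h1]
  have h2 := (volume_preserving_finTwoArrow ℝ).setIntegral_preimage_emb
    (MeasurableEquiv.measurableEmbedding _) g sq2
  rw [← h2]
  congr 1
  congr 1
  ext z
  simp [sq2, Fin.forall_fin_two, hb]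

theorem ae_eq_Omg (h : ℝ) : Omg h =ᵐ[volume] Set.Icc (0 : R3) ![2 * π, 2 * π, h] := by
  have h1 : (Set.pi Set.univ fun i : Fin 3 => Set.Ioo ((0 : R3) i) ((![2 * π, 2 * π, h] : R3) i))
      =ᵐ[volume] Set.Icc (0 : R3) ![2 * π, 2 * π, h] := Measure.univ_pi_Ioo_ae_eq_Icc
  have h2 : Omg h
      = Set.pi Set.univ fun i : Fin 3 => Set.Ioo ((0 : R3) i) ((![2 * π, 2 * π, h] : R3) i) := by
    ext z
    simp [Omg, Fin.forall_fin_succ]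
  rwa [h2]

theorem integrableOn_Omg {E : Type*} [NormedAddCommGroup E] (h : ℝ) {g : R3 → E}
    (hg : Continuous g) : IntegrableOn g (Omg h) := by
  rw [integrableOn_congr_set_ae (ae_eq_Omg h)]
  exact hg.continuousOn.integrableOn_compact isCompact_Icc

theorem isOpen_Omg (h : ℝ) : IsOpen (Omg h) :=
  ((isOpen_Ioo.preimage (continuous_apply 0)).inter
    ((isOpen_Ioo.preimage (continuous_apply 1)).inter (isOpen_Ioo.preimage (continuous_apply 2))))

theorem measurableSet_Omg (h : ℝ) : MeasurableSet (Omg h) := (isOpen_Omg h).measurableSet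

/-- The divergence theorem on the periodicity cell: the lateral faces cancel. -/
theorem setIntegral_Omg_div {h : ℝ} (hh : 0 < h) {W : Fin 3 → R3 → ℂ}
    (hW : ∀ i, ContDiff ℝ 1 (W i)) (hper : ∀ i, Biperiodic (W i)) :
    ∫ x in Omg h, ∑ i, pdC i (W i) x
      = (∫ p in sq2, W 2 (bpt p h)) - ∫ p in sq2, W 2 (bpt p 0) := by
  have hle : (0 : R3) ≤ ![2 * π, 2 * π, h] := by
    intro i
    have := Real.pi_pos
    fin_cases i <;> simp <;> positivity
  have key := integral_divergence_of_hasFDerivAt_off_countable' (0 : R3) ![2 * π, 2 * π, h] hle W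
    (fun i x => fderiv ℝ (W i) x) ∅ Set.countable_empty (fun i => (hW i).continuous.continuousOn)
    (fun x _ i => ((hW i).differentiable (by norm_num) x).hasFDerivAt)
    (by
      refine ContinuousOn.integrableOn_compact isCompact_Icc (Continuous.continuousOn ?_)
      exact continuous_finsetSum _ fun i _ => continuous_pdC (hW i))
  rw [setIntegral_congr_set (ae_eq_Omg h)]
  change (∫ x in Set.Icc (0 : R3) ![2 * π, 2 * π, h], ∑ i, pdC i (W i) x) = _ at key
  rw [key, Fin.sum_univ_three]
  have h0 : ∀ z : Fin 2 → ℝ, W 0 (Fin.insertNth (α := fun _ => ℝ) 0 (2 * π) z)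
      = W 0 (Fin.insertNth (α := fun _ => ℝ) 0 0 z) := by
    intro z
    rw [← (hper 0 (Fin.insertNth (α := fun _ => ℝ) 0 0 z)).1]
    congr 1
    ext i
    fin_cases i
    · simp
    · change z 0 = z 0 + _
      simp
    · change z 1 = z 1 + _
      simp
  have h1 : ∀ z : Fin 2 → ℝ, W 1 (Fin.insertNth (α := fun _ => ℝ) 1 (2 * π) z)
      = W 1 (Fin.insertNth (α := fun _ => ℝ) 1 0 z) := by
    intro z
    rw [← (hper 1 (Fin.insertNth (α := fun _ => ℝ) 1 0 z)).2]
    congr 1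
    ext i
    fin_cases i
    · change z 0 = z 0 + _
      simp
    · change 2 * π = 0 + _
      simp
    · change z 1 = z 1 + _
      simp
  have h2 : ∀ (z : Fin 2 → ℝ) (t : ℝ),
      Fin.insertNth (α := fun _ => ℝ) 2 t z = bpt (z 0, z 1) t := by
    intro z t
    ext i
    fin_cases i <;> rfl
  have hb : ∀ i : Fin 2, ((![2 * π, 2 * π, h] : R3) ∘ Fin.succAbove 2) i = 2 * π := by
    intro i
    fin_cases i <;> rfl
  have h3 := fun t : ℝ => integral_Icc_fin_two (g := fun p => W 2 (bpt p t)) hb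
  have e0 : (0 : R3) ∘ Fin.succAbove 2 = (0 : Fin 2 → ℝ) := rfl
  simp only [Matrix.cons_val_zero, Matrix.cons_val_one, Matrix.cons_val, Pi.zero_apply,
    h0, h1, h2, e0, h3, sub_self, zero_add]

theorem continuous_comp_bpt {E : Type*} [TopologicalSpace E] {f : R3 → E} (hf : Continuous f)
    (t : ℝ) : Continuous fun p : ℝ × ℝ => f (bpt p t) :=
  hf.comp (continuous_bpt.comp (by fun_prop : Continuous fun p : ℝ × ℝ => (p, t)))

theorem bpt_add_zero (x y t : ℝ) :
    bpt (x + 2 * π, y) t = bpt (x, y) t + (2 * π) • (Pi.single 0 1 : R3) := by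
  ext i
  fin_cases i <;> simp [bpt]

theorem bpt_add_one (x y t : ℝ) :
    bpt (x, y + 2 * π) t = bpt (x, y) t + (2 * π) • (Pi.single 1 1 : R3) := by
  ext i
  fin_cases i <;> simp [bpt]

theorem hasDerivAt_bpt_fst {f : R3 → ℂ} (hf : ContDiff ℝ 1 f) (x y t : ℝ) :
    HasDerivAt (fun s => f (bpt (s, y) t)) (pdC 0 f (bpt (x, y) t)) x := by
  have h1 : HasDerivAt (fun s => bpt (s, y) t) (Pi.single 0 1 : R3) x := by
    rw [hasDerivAt_pi]
    intro i
    fin_cases i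
    · simpa [bpt] using hasDerivAt_id' x
    · simpa [bpt] using hasDerivAt_const x y
    · simpa [bpt] using hasDerivAt_const x t
  exact (hf.differentiable (by norm_num) _).hasFDerivAt.comp_hasDerivAt x h1

theorem hasDerivAt_bpt_snd {f : R3 → ℂ} (hf : ContDiff ℝ 1 f) (x y t : ℝ) :
    HasDerivAt (fun s => f (bpt (x, s) t)) (pdC 1 f (bpt (x, y) t)) y := by
  have h1 : HasDerivAt (fun s => bpt (x, s) t) (Pi.single 1 1 : R3) y := by
    rw [hasDerivAt_pi]
    intro i
    fin_cases i
    · simpa [bpt] using hasDerivAt_const y x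
    · simpa [bpt] using hasDerivAt_id' y
    · simpa [bpt] using hasDerivAt_const y t
  exact (hf.differentiable (by norm_num) _).hasFDerivAt.comp_hasDerivAt y h1

theorem hasDerivAt_bpt_height {f : R3 → ℂ} (hf : ContDiff ℝ 1 f) (p : ℝ × ℝ) (t : ℝ) :
    HasDerivAt (fun s => f (bpt p s)) (pdC 2 f (bpt p t)) t := by
  have h1 : HasDerivAt (fun s => bpt p s) (Pi.single 2 1 : R3) t := by
    rw [hasDerivAt_pi]
    intro i
    fin_cases i
    · simpa [bpt] using hasDerivAt_const t p.1
    · simpa [bpt] using hasDerivAt_const t p.2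
    · simpa [bpt] using hasDerivAt_id' t
  exact (hf.differentiable (by norm_num) _).hasFDerivAt.comp_hasDerivAt t h1

/-- The Fourier coefficient of order `n` of a scalar function at height `t`. -/
def sqCoeff (f : R3 → ℂ) (n : ℤ × ℤ) (t : ℝ) : ℂ :=
  (1 / (4 * (π : ℂ) ^ 2)) *
    ∫ p in sq2, f (bpt p t) *
      Complex.exp (-Complex.I * (((n.1 : ℝ) * p.1 + (n.2 : ℝ) * p.2 : ℝ) : ℂ))

theorem norm_exp_neg_I_mul (x : ℝ) : ‖Complex.exp (-Complex.I * (x : ℂ))‖ = 1 := by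
  have : -Complex.I * (x : ℂ) = ((-x : ℝ) : ℂ) * Complex.I := by push_cast; ring
  rw [this, Complex.norm_exp_ofReal_mul_I]

theorem integrableOn_mul_exp {f : R3 → ℂ} (hf : Continuous f) (n : ℤ × ℤ) (t : ℝ) :
    IntegrableOn (fun p : ℝ × ℝ => f (bpt p t) *
      Complex.exp (-Complex.I * (((n.1 : ℝ) * p.1 + (n.2 : ℝ) * p.2 : ℝ) : ℂ))) sq2 :=
  integrableOn_sq2 ((continuous_comp_bpt hf t).mul (by fun_prop))

theorem sqCoeff_add {f g : R3 → ℂ} (hf : Continuous f) (hg : Continuous g) (n : ℤ × ℤ) (t : ℝ) :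
    sqCoeff (fun x => f x + g x) n t = sqCoeff f n t + sqCoeff g n t := by
  simp only [sqCoeff, add_mul]
  rw [integral_add (integrableOn_mul_exp hf n t) (integrableOn_mul_exp hg n t)]
  ring

theorem sqCoeff_sub {f g : R3 → ℂ} (hf : Continuous f) (hg : Continuous g) (n : ℤ × ℤ) (t : ℝ) :
    sqCoeff (fun x => f x - g x) n t = sqCoeff f n t - sqCoeff g n t := by
  simp only [sqCoeff, sub_mul]
  rw [integral_sub (integrableOn_mul_exp hf n t) (integrableOn_mul_exp hg n t)]
  ring

theorem sqCoeff_const_mul (c : ℂ) (f : R3 → ℂ) (n : ℤ × ℤ) (t : ℝ) :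
    sqCoeff (fun x => c * f x) n t = c * sqCoeff f n t := by
  simp only [sqCoeff, mul_assoc]
  rw [integral_const_mul]
  ring

theorem sqCoeff_congr {f g : R3 → ℂ} {t : ℝ} (h : ∀ p ∈ sq2, f (bpt p t) = g (bpt p t))
    (n : ℤ × ℤ) : sqCoeff f n t = sqCoeff g n t := by
  simp only [sqCoeff]
  congr 1
  exact setIntegral_congr_fun measurableSet_sq2 fun p hp => by simp only [h p hp]

theorem exp_neg_I_shift_fst (n : ℤ × ℤ) (y : ℝ) :
    Complex.exp (-Complex.I * (((n.1 : ℝ) * (0 + 2 * π) + (n.2 : ℝ) * y : ℝ) : ℂ))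
      = Complex.exp (-Complex.I * (((n.1 : ℝ) * 0 + (n.2 : ℝ) * y : ℝ) : ℂ)) := by
  rw [Complex.exp_eq_exp_iff_exists_int]
  exact ⟨-n.1, by push_cast; ring⟩

theorem exp_neg_I_shift_snd (n : ℤ × ℤ) (x : ℝ) :
    Complex.exp (-Complex.I * (((n.1 : ℝ) * x + (n.2 : ℝ) * (0 + 2 * π) : ℝ) : ℂ))
      = Complex.exp (-Complex.I * (((n.1 : ℝ) * x + (n.2 : ℝ) * 0 : ℝ) : ℂ)) := by
  rw [Complex.exp_eq_exp_iff_exists_int]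
  exact ⟨-n.2, by push_cast; ring⟩

theorem sqCoeff_eq_of_integral_eq_zero {f g : R3 → ℂ} (hf : Continuous f) (hg : Continuous g)
    {n : ℤ × ℤ} {t : ℝ} {c : ℂ}
    (h : ∫ p in sq2, (g (bpt p t) *
        Complex.exp (-Complex.I * (((n.1 : ℝ) * p.1 + (n.2 : ℝ) * p.2 : ℝ) : ℂ))
      + f (bpt p t) * (Complex.exp (-Complex.I * (((n.1 : ℝ) * p.1 + (n.2 : ℝ) * p.2 : ℝ) : ℂ))
        * (-Complex.I * c))) = 0) :
    sqCoeff g n t = Complex.I * c * sqCoeff f n t := by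
  simp only [← mul_assoc] at h
  rw [integral_add (integrableOn_mul_exp hg n t)
    (((integrableOn_mul_exp hf n t).mul_const _).mul_const _), integral_mul_const,
    integral_mul_const] at h
  simp only [sqCoeff]
  linear_combination (1 / (4 * (π : ℂ) ^ 2)) * h

theorem sqCoeff_pdC_zero {f : R3 → ℂ} (hf : ContDiff ℝ 1 f) (hper : Biperiodic f) (n : ℤ × ℤ)
    (t : ℝ) : sqCoeff (pdC 0 f) n t = Complex.I * (n.1 : ℂ) * sqCoeff f n t := by
  set e : ℝ × ℝ → ℂ := fun p =>
    Complex.exp (-Complex.I * (((n.1 : ℝ) * p.1 + (n.2 : ℝ) * p.2 : ℝ) : ℂ)) with he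
  have hec : Continuous e := by fun_prop
  have hfc := continuous_comp_bpt hf.continuous t
  have hdc := continuous_comp_bpt (continuous_pdC (i := 0) hf) t
  have hcont : Continuous fun p : ℝ × ℝ =>
      pdC 0 f (bpt p t) * e p + f (bpt p t) * (e p * (-Complex.I * (n.1 : ℂ))) :=
    (hdc.mul hec).add (hfc.mul (hec.mul continuous_const))
  refine sqCoeff_eq_of_integral_eq_zero hf.continuous (continuous_pdC hf) ?_
  rw [setIntegral_sq2_eq_swap hcont]
  refine intervalIntegral.integral_zero_ae (Filter.Eventually.of_forall fun y _ => ?_)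
  have hd : ∀ x ∈ Set.uIcc (0 : ℝ) (2 * π), HasDerivAt (fun s => f (bpt (s, y) t) * e (s, y))
      (pdC 0 f (bpt (x, y) t) * e (x, y)
        + f (bpt (x, y) t) * (e (x, y) * (-Complex.I * (n.1 : ℂ)))) x := by
    intro x _
    refine (hasDerivAt_bpt_fst hf x y t).mul ?_
    refine HasDerivAt.cexp ?_
    refine HasDerivAt.const_mul _ ?_
    refine HasDerivAt.ofReal_comp (u := (n.1 : ℝ)) ?_
    simpa using ((hasDerivAt_id x).const_mul (n.1 : ℝ)).add_const ((n.2 : ℝ) * y)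
  rw [intervalIntegral.integral_eq_sub_of_hasDerivAt hd
    ((hcont.comp (by fun_prop : Continuous fun x : ℝ => (x, y))).intervalIntegrable _ _)]
  have h1 : f (bpt (2 * π, y) t) = f (bpt (0, y) t) := by
    rw [← (hper (bpt (0, y) t)).1, ← bpt_add_zero, zero_add]
  have h2 : e (2 * π, y) = e (0, y) := by
    have := exp_neg_I_shift_fst n y
    rwa [zero_add] at this
  rw [h1, h2, sub_self]

theorem sqCoeff_pdC_one {f : R3 → ℂ} (hf : ContDiff ℝ 1 f) (hper : Biperiodic f) (n : ℤ × ℤ)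
    (t : ℝ) : sqCoeff (pdC 1 f) n t = Complex.I * (n.2 : ℂ) * sqCoeff f n t := by
  set e : ℝ × ℝ → ℂ := fun p =>
    Complex.exp (-Complex.I * (((n.1 : ℝ) * p.1 + (n.2 : ℝ) * p.2 : ℝ) : ℂ)) with he
  have hec : Continuous e := by fun_prop
  have hfc := continuous_comp_bpt hf.continuous t
  have hdc := continuous_comp_bpt (continuous_pdC (i := 1) hf) t
  have hcont : Continuous fun p : ℝ × ℝ =>
      pdC 1 f (bpt p t) * e p + f (bpt p t) * (e p * (-Complex.I * (n.2 : ℂ))) :=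
    (hdc.mul hec).add (hfc.mul (hec.mul continuous_const))
  refine sqCoeff_eq_of_integral_eq_zero hf.continuous (continuous_pdC hf) ?_
  rw [setIntegral_sq2_eq hcont]
  refine intervalIntegral.integral_zero_ae (Filter.Eventually.of_forall fun x _ => ?_)
  have hd : ∀ y ∈ Set.uIcc (0 : ℝ) (2 * π), HasDerivAt (fun s => f (bpt (x, s) t) * e (x, s))
      (pdC 1 f (bpt (x, y) t) * e (x, y)
        + f (bpt (x, y) t) * (e (x, y) * (-Complex.I * (n.2 : ℂ)))) y := by
    intro y _
    refine (hasDerivAt_bpt_snd hf x y t).mul ?_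
    refine HasDerivAt.cexp ?_
    refine HasDerivAt.const_mul _ ?_
    refine HasDerivAt.ofReal_comp (u := (n.2 : ℝ)) ?_
    simpa using ((hasDerivAt_id y).const_mul (n.2 : ℝ)).const_add ((n.1 : ℝ) * x)
  rw [intervalIntegral.integral_eq_sub_of_hasDerivAt hd
    ((hcont.comp (by fun_prop : Continuous fun y : ℝ => (x, y))).intervalIntegrable _ _)]
  have h1 : f (bpt (x, 2 * π) t) = f (bpt (x, 0) t) := by
    rw [← (hper (bpt (x, 0) t)).2, ← bpt_add_one, zero_add]
  have h2 : e (x, 2 * π) = e (x, 0) := by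
    have := exp_neg_I_shift_snd n x
    rwa [zero_add] at this
  rw [h1, h2, sub_self]

theorem hasDerivAt_sqCoeff {f : R3 → ℂ} (hf : ContDiff ℝ 1 f) (n : ℤ × ℤ) (t : ℝ) :
    HasDerivAt (sqCoeff f n) (sqCoeff (pdC 2 f) n t) t := by
  refine HasDerivAt.const_mul _ ?_
  have hK : IsCompact ((Set.Icc (0 : ℝ) (2 * π) ×ˢ Set.Icc (0 : ℝ) (2 * π))
      ×ˢ Set.Icc (t - 1) (t + 1)) := isCompact_closedSquare.prod isCompact_Icc
  obtain ⟨M, hM⟩ := hK.exists_bound_of_continuousOn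
    ((continuous_pdC (i := 2) hf).comp continuous_bpt).continuousOn
  refine (hasDerivAt_integral_of_dominated_loc_of_deriv_le (μ := volume.restrict sq2)
    (F := fun s p => f (bpt p s) *
      Complex.exp (-Complex.I * (((n.1 : ℝ) * p.1 + (n.2 : ℝ) * p.2 : ℝ) : ℂ)))
    (F' := fun s p => pdC 2 f (bpt p s) *
      Complex.exp (-Complex.I * (((n.1 : ℝ) * p.1 + (n.2 : ℝ) * p.2 : ℝ) : ℂ)))
    (s := Set.Icc (t - 1) (t + 1)) (bound := fun _ => M)
    (Icc_mem_nhds (by linarith) (by linarith))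
    (Filter.Eventually.of_forall fun s => (integrableOn_mul_exp hf.continuous n s).1)
    (integrableOn_mul_exp hf.continuous n t)
    (integrableOn_mul_exp (continuous_pdC hf) n t).1 ?_
    (integrableOn_const (by exact volume_sq2_lt_top.ne)) ?_).2
  · filter_upwards [ae_restrict_mem measurableSet_sq2] with p hp s hs
    rw [norm_mul, norm_exp_neg_I_mul, mul_one]
    exact hM (p, s) ⟨sq2_subset hp, hs⟩
  · exact Filter.Eventually.of_forall fun p s _ => (hasDerivAt_bpt_height hf p s).mul_const _

theorem exists_norm_sqCoeff_le {f : R3 → ℂ} (hf : Continuous f) (t : ℝ) :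
    ∃ M, ∀ n, ‖sqCoeff f n t‖ ≤ M := by
  obtain ⟨M, hM⟩ := isCompact_closedSquare.exists_bound_of_continuousOn
    (continuous_comp_bpt hf t).continuousOn
  refine ⟨‖(1 / (4 * (π : ℂ) ^ 2))‖ * (M * volume.real sq2), fun n => ?_⟩
  rw [sqCoeff, norm_mul]
  refine mul_le_mul_of_nonneg_left ?_ (norm_nonneg _)
  refine norm_setIntegral_le_of_norm_le_const volume_sq2_lt_top fun p hp => ?_
  rw [norm_mul, norm_exp_neg_I_mul, mul_one]
  exact hM p (sq2_subset hp)

theorem hasSum_fourier_of_periodic {v : ℝ → ℂ} (hv : Continuous v)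
    (hper : Function.Periodic v (2 * π)) {c : ℤ → ℂ}
    (hc : ∀ m, c m = (1 / (2 * (π : ℂ))) *
      ∫ x in (0)..(2 * π), v x * Complex.exp (-Complex.I * (((m : ℝ) * x : ℝ) : ℂ)))
    (hs : Summable c) (x : ℝ) :
    HasSum (fun m => c m * Complex.exp (Complex.I * (((m : ℝ) * x : ℝ) : ℂ))) (v x) := by
  have : Fact (0 < 2 * π) := ⟨by positivity⟩
  let F : C(AddCircle (2 * π), ℂ) :=
    ⟨hper.lift, by
      refine continuous_coinduced_dom.mpr ?_
      exact hv⟩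
  have hF : ∀ y : ℝ, F (y : AddCircle (2 * π)) = v y := fun y => hper.lift_coe y
  have hexp : ∀ (m : ℤ) (y : ℝ), (fourier m (y : AddCircle (2 * π)) : ℂ)
      = Complex.exp (Complex.I * (((m : ℝ) * y : ℝ) : ℂ)) := by
    intro m y
    rw [fourier_coe_apply]
    congr 1
    have : (π : ℂ) ≠ 0 := by exact_mod_cast Real.pi_ne_zero
    push_cast
    field_simp
  have hcoef : ∀ m, fourierCoeff F m = c m := by
    intro m
    rw [fourierCoeff_eq_intervalIntegral F m 0, hc, zero_add]
    rw [Complex.real_smul]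
    push_cast
    congr 1
    refine intervalIntegral.integral_congr fun y _ => ?_
    simp only [hF, hexp, smul_eq_mul]
    rw [mul_comm]
    congr 2
    push_cast
    ring
  have h := has_pointwise_sum_fourier_series_of_summable (f := F)
    (by rwa [show fourierCoeff F = c from funext hcoef]) (x : AddCircle (2 * π))
  simpa only [hcoef, hexp, hF, smul_eq_mul] using h

theorem norm_exp_I_mul (x : ℝ) : ‖Complex.exp (Complex.I * (x : ℂ))‖ = 1 := by
  rw [mul_comm, Complex.norm_exp_ofReal_mul_I]

theorem hasSum_sqCoeff {f : R3 → ℂ} (hf : Continuous f) (hper : Biperiodic f) {t : ℝ}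
    (hs : Summable fun n => ‖sqCoeff f n t‖) (p : ℝ × ℝ) :
    HasSum (fun n : ℤ × ℤ => sqCoeff f n t *
      Complex.exp (Complex.I * (((n.1 : ℝ) * p.1 + (n.2 : ℝ) * p.2 : ℝ) : ℂ))) (f (bpt p t)) := by
  obtain ⟨x, y⟩ := p
  have hu := continuous_comp_bpt hf t
  let g : ℤ → ℝ → ℂ := fun m y => (1 / (2 * (π : ℂ))) *
    ∫ x in (0)..(2 * π), f (bpt (x, y) t) * Complex.exp (-Complex.I * (((m : ℝ) * x : ℝ) : ℂ))
  have hgc : ∀ m, Continuous (g m) := by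
    intro m
    refine continuous_const.mul ?_
    refine intervalIntegral.continuous_parametric_intervalIntegral_of_continuous' ?_ _ _
    refine Continuous.mul ?_ (by fun_prop)
    exact hu.comp (by fun_prop : Continuous fun q : ℝ × ℝ => (q.2, q.1))
  have hgp : ∀ m, Function.Periodic (g m) (2 * π) := by
    intro m y
    simp only [g, bpt_add_one, (hper _).2]
  have hgcoef : ∀ m k, sqCoeff f (m, k) t = (1 / (2 * (π : ℂ))) *
      ∫ y in (0)..(2 * π), g m y * Complex.exp (-Complex.I * (((k : ℝ) * y : ℝ) : ℂ)) := by
    intro m k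
    have hint : Continuous fun p : ℝ × ℝ => f (bpt p t) *
        Complex.exp (-Complex.I * (((m : ℝ) * p.1 + (k : ℝ) * p.2 : ℝ) : ℂ)) :=
      hu.mul (by fun_prop)
    simp only [sqCoeff]
    rw [setIntegral_sq2_eq_swap hint]
    simp only [g, mul_assoc (1 / (2 * (π : ℂ)))]
    rw [intervalIntegral.integral_const_mul, ← mul_assoc]
    congr 1
    · ring
    · refine intervalIntegral.integral_congr fun y _ => ?_
      rw [← intervalIntegral.integral_mul_const]
      refine intervalIntegral.integral_congr fun x _ => ?_
      rw [mul_assoc, ← Complex.exp_add]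
      congr 2
      push_cast
      ring
  have hin : ∀ m, HasSum (fun k => sqCoeff f (m, k) t *
      Complex.exp (Complex.I * (((k : ℝ) * y : ℝ) : ℂ))) (g m y) := fun m =>
    hasSum_fourier_of_periodic (hgc m) (hgp m) (hgcoef m)
      (hs.of_norm.comp_injective (Prod.mk_right_injective m)) y
  set T : ℤ × ℤ → ℂ := fun n => sqCoeff f n t *
      Complex.exp (Complex.I * (((n.1 : ℝ) * x + (n.2 : ℝ) * y : ℝ) : ℂ)) with hT
  have hTs : Summable T := by
    refine Summable.of_norm ?_
    simpa only [hT, norm_mul, norm_exp_I_mul, mul_one] using hs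
  have hinT : ∀ m, HasSum (fun k => T (m, k))
      (g m y * Complex.exp (Complex.I * (((m : ℝ) * x : ℝ) : ℂ))) := by
    intro m
    convert! (hin m).mul_right (Complex.exp (Complex.I * (((m : ℝ) * x : ℝ) : ℂ))) using 1
    funext k
    simp only [hT]
    rw [mul_assoc, ← Complex.exp_add]
    congr 2
    push_cast
    ring
  have hout := hTs.hasSum.prod_fiberwise hinT
  have hgs : Summable fun m => g m y := by
    refine Summable.of_norm_bounded (g := fun m => ∑' k, ‖sqCoeff f (m, k) t‖) hs.prod ?_
    intro m
    rw [← (hin m).tsum_eq]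
    refine (norm_tsum_le_tsum_norm ?_).trans (le_of_eq ?_)
    · simp only [norm_mul, norm_exp_I_mul, mul_one]
      exact hs.comp_injective (Prod.mk_right_injective m)
    · simp only [norm_mul, norm_exp_I_mul, mul_one]
  have hfin := hasSum_fourier_of_periodic (v := fun x => f (bpt (x, y) t))
    (hu.comp (by fun_prop : Continuous fun x : ℝ => (x, y)))
    (fun x => by simp only [bpt_add_zero, (hper _).1]) (c := fun m => g m y) (fun m => rfl) hgs x
  rw [hfin.unique hout]
  exact hTs.hasSum

theorem integral_conj_exp {g : R3 → ℂ} (n : ℤ × ℤ) (t : ℝ) :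
    ∫ p in sq2, Complex.exp (Complex.I * (((n.1 : ℝ) * p.1 + (n.2 : ℝ) * p.2 : ℝ) : ℂ))
      * (starRingEnd ℂ) (g (bpt p t)) = 4 * (π : ℂ) ^ 2 * (starRingEnd ℂ) (sqCoeff g n t) := by
  rw [sqCoeff, map_mul, ← integral_conj]
  have : (starRingEnd ℂ) (1 / (4 * (π : ℂ) ^ 2)) = 1 / (4 * (π : ℂ) ^ 2) := by
    have h4 : (1 / (4 * (π : ℂ) ^ 2)) = ((1 / (4 * π ^ 2) : ℝ) : ℂ) := by push_cast; rfl
    rw [h4, Complex.conj_ofReal]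
  rw [this, ← mul_assoc, mul_one_div_cancel (by simp [Real.pi_ne_zero]), one_mul]
  congr 1
  funext p
  rw [map_mul, ← Complex.exp_conj, mul_comm]
  simp

/-- The Parseval identity on a horizontal face. -/
theorem hasSum_sqCoeff_mul_conj {f g : R3 → ℂ} (hf : Continuous f) (hper : Biperiodic f)
    (hg : Continuous g) {t : ℝ} (hs : Summable fun n => ‖sqCoeff f n t‖) :
    HasSum (fun n => 4 * (π : ℂ) ^ 2 * (sqCoeff f n t * (starRingEnd ℂ) (sqCoeff g n t)))
      (∫ p in sq2, f (bpt p t) * (starRingEnd ℂ) (g (bpt p t))) := by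
  have hgc := continuous_comp_bpt hg t
  obtain ⟨M, hM⟩ := isCompact_closedSquare.exists_bound_of_continuousOn hgc.continuousOn
  have key := hasSum_integral_of_dominated_convergence (μ := volume.restrict sq2)
    (F := fun (n : ℤ × ℤ) (p : ℝ × ℝ) => sqCoeff f n t *
      Complex.exp (Complex.I * (((n.1 : ℝ) * p.1 + (n.2 : ℝ) * p.2 : ℝ) : ℂ))
        * (starRingEnd ℂ) (g (bpt p t)))
    (f := fun p => f (bpt p t) * (starRingEnd ℂ) (g (bpt p t)))
    (fun n _ => ‖sqCoeff f n t‖ * M)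
    (fun n => (integrableOn_sq2 (((continuous_const.mul (by fun_prop)).mul
      (Complex.continuous_conj.comp hgc)))).1)
    (fun n => by
      filter_upwards [ae_restrict_mem measurableSet_sq2] with p hp
      rw [norm_mul, norm_mul, norm_exp_I_mul, mul_one, RCLike.norm_conj]
      exact mul_le_mul_of_nonneg_left (hM p (sq2_subset hp)) (norm_nonneg _))
    (Filter.Eventually.of_forall fun _ => hs.mul_right M)
    (integrableOn_const (by exact volume_sq2_lt_top.ne))
    (Filter.Eventually.of_forall fun p => (hasSum_sqCoeff hf hper hs p).mul_right _)
  convert! key using 1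
  funext n
  simp only [mul_assoc]
  rw [integral_const_mul, integral_conj_exp]
  ring

theorem betaN_sq (k : ℝ) (α : R3) (n : ℤ × ℤ) :
    betaN k α n ^ 2
      = (k : ℂ) ^ 2 - (((n.1 : ℂ) + (α 0 : ℂ)) ^ 2 + ((n.2 : ℂ) + (α 1 : ℂ)) ^ 2) := by
  unfold betaN
  split_ifs with h
  · rw [← Complex.ofReal_pow, Real.sq_sqrt (by linarith)]
    push_cast
    ring
  · rw [mul_pow, Complex.I_sq, ← Complex.ofReal_pow, Real.sq_sqrt (by linarith)]
    push_cast
    ring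

theorem betaN_re_nonneg (k : ℝ) (α : R3) (n : ℤ × ℤ) : 0 ≤ (betaN k α n).re := by
  unfold betaN
  split_ifs with h
  · simp
  · simp

theorem le_betaN_im (k : ℝ) (hk : 0 < k) (α : R3) (n : ℤ × ℤ) :
    (|(n.1 : ℝ) + α 0| + |(n.2 : ℝ) + α 1|) / 2 - k ≤ (betaN k α n).im := by
  have h0 := sq_abs ((n.1 : ℝ) + α 0)
  have h1 := sq_abs ((n.2 : ℝ) + α 1)
  have p0 := abs_nonneg ((n.1 : ℝ) + α 0)
  have p1 := abs_nonneg ((n.2 : ℝ) + α 1)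
  unfold betaN
  rw [← h0, ← h1]
  generalize |(n.1 : ℝ) + α 0| = a at *
  generalize |(n.2 : ℝ) + α 1| = b at *
  split_ifs with h
  · simp only [Complex.ofReal_im]
    nlinarith [sq_nonneg (a - b)]
  · simp only [Complex.mul_im, Complex.I_re, Complex.I_im, Complex.ofReal_re, Complex.ofReal_im,
      zero_mul, one_mul, zero_add]
    rcases le_or_gt ((a + b) / 2 - k) 0 with h2 | h2
    · exact h2.trans (Real.sqrt_nonneg _)
    · refine Real.le_sqrt_of_sq_le ?_
      nlinarith [sq_nonneg (a - b)]

theorem summable_exp_neg_mul_abs {c : ℝ} (hc : 0 < c) :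
    Summable fun m : ℤ => Real.exp (-c * |(m : ℝ)|) := by
  have h : Summable fun m : ℕ => Real.exp (-c * (m : ℝ)) := by
    refine (Real.summable_exp_nat_mul_of_ge (c := -c) (by linarith) (f := fun m => (m : ℝ))
      fun _ => le_rfl)
  refine Summable.of_nat_of_neg ?_ ?_ <;> simpa using h

theorem summable_exp_neg_betaN_im {k : ℝ} (hk : 0 < k) (α : R3) {δ : ℝ} (hδ : 0 < δ) :
    Summable fun n : ℤ × ℤ => Real.exp (-δ * (betaN k α n).im) := by
  have h1 := summable_exp_neg_mul_abs (c := δ / 2) (by positivity)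
  have h2 := (h1.mul_of_nonneg h1 (fun _ => (Real.exp_pos _).le)
    (fun _ => (Real.exp_pos _).le)).mul_left (Real.exp (δ * (k + (|α 0| + |α 1|) / 2)))
  refine Summable.of_nonneg_of_le (fun _ => (Real.exp_pos _).le) (fun n => ?_) h2
  rw [← Real.exp_add, ← Real.exp_add]
  refine Real.exp_le_exp.mpr ?_
  have h3 := le_betaN_im k hk α n
  have h4 := abs_sub_abs_le_abs_sub (n.1 : ℝ) (-α 0)
  have h5 := abs_sub_abs_le_abs_sub (n.2 : ℝ) (-α 1)
  rw [abs_neg, sub_neg_eq_add] at h4 h5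
  have h6 : (|(n.1 : ℝ)| + |(n.2 : ℝ)|) / 2 - (k + (|α 0| + |α 1|) / 2) ≤ (betaN k α n).im := by
    linarith
  nlinarith [mul_le_mul_of_nonneg_left h6 hδ.le]

theorem eq_mul_exp_of_hasDerivAt {u : ℝ → ℂ} {c : ℂ} {a b : ℝ} (hab : a ≤ b)
    (hu : ContinuousOn u (Set.Icc a b)) (hd : ∀ t ∈ Set.Ico a b, HasDerivAt u (c * u t) t) :
    u b = Complex.exp (c * (b - a : ℝ)) * u a := by
  have hw : ∀ t ∈ Set.Icc a b, (fun s : ℝ => Complex.exp (-c * (s : ℂ)) * u s) t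
      = Complex.exp (-c * (a : ℂ)) * u a := by
    refine constant_of_has_deriv_right_zero ?_ ?_
    · exact (Continuous.continuousOn (by fun_prop)).mul hu
    · intro t ht
      have h1 : HasDerivAt (fun s : ℝ => Complex.exp (-c * (s : ℂ)))
          (Complex.exp (-c * (t : ℂ)) * (-c)) t := by
        refine HasDerivAt.cexp ?_
        simpa using (Complex.ofRealCLM.hasDerivAt (x := t)).const_mul (-c)
      have h2 := h1.mul (hd t ht)
      convert! h2.hasDerivWithinAt using 1
      ring
  have h := hw b ⟨hab, le_rfl⟩
  simp only at h
  have h3 : Complex.exp (c * (b : ℂ)) * Complex.exp (-c * (b : ℂ)) = 1 := by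
    rw [← Complex.exp_add]; simp
  have h4 : Complex.exp (c * (b - a : ℝ))
      = Complex.exp (c * (b : ℂ)) * Complex.exp (-c * (a : ℂ)) := by
    rw [← Complex.exp_add]
    congr 1
    push_cast
    ring
  rw [h4, mul_assoc, ← h, ← mul_assoc, h3, one_mul]

/-- Solutions of the mode equation with outgoing data at the top end stay outgoing. -/
theorem outgoing_of_hasDerivAt {u v : ℝ → ℂ} {β : ℂ} {a b : ℝ}
    (hu : ∀ t, HasDerivAt u (v t) t) (hvc : Continuous v)
    (hv : ∀ t ∈ Set.Ioo a b, HasDerivAt v (-β ^ 2 * u t) t) (hb : v b = Complex.I * β * u b) :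
    ∀ t ∈ Set.Ioo a b, v t = Complex.I * β * u t := by
  intro t ht
  have huc : Continuous u := continuous_iff_continuousAt.mpr fun s => (hu s).continuousAt
  have h := eq_mul_exp_of_hasDerivAt (u := fun s => v s - Complex.I * β * u s)
    (c := -Complex.I * β) ht.2.le (by fun_prop) (by
      intro s hs
      have h1 := (hv s ⟨ht.1.trans_le hs.1, hs.2⟩).sub ((hu s).const_mul (Complex.I * β))
      convert! h1 using 1
      linear_combination (β ^ 2 * u s) * Complex.I_sq)
  rw [hb, sub_self, eq_comm, mul_eq_zero, or_iff_right (Complex.exp_ne_zero _), sub_eq_zero] at h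
  exact h

theorem sqCoeff_pdA_zero {α : R3} {f : R3 → ℂ} (hf : ContDiff ℝ 1 f) (hper : Biperiodic f)
    (n : ℤ × ℤ) (t : ℝ) :
    sqCoeff (pdA α 0 f) n t = Complex.I * ((n.1 : ℂ) + (α 0 : ℂ)) * sqCoeff f n t := by
  have h := sqCoeff_add (g := fun x => Complex.I * (α 0 : ℂ) * f x) (continuous_pdC (i := 0) hf)
    (continuous_const.mul hf.continuous) n t
  rw [sqCoeff_const_mul, sqCoeff_pdC_zero hf hper] at h
  exact h.trans (by ring)

theorem sqCoeff_pdA_one {α : R3} {f : R3 → ℂ} (hf : ContDiff ℝ 1 f) (hper : Biperiodic f)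
    (n : ℤ × ℤ) (t : ℝ) :
    sqCoeff (pdA α 1 f) n t = Complex.I * ((n.2 : ℂ) + (α 1 : ℂ)) * sqCoeff f n t := by
  have h := sqCoeff_add (g := fun x => Complex.I * (α 1 : ℂ) * f x) (continuous_pdC (i := 1) hf)
    (continuous_const.mul hf.continuous) n t
  rw [sqCoeff_const_mul, sqCoeff_pdC_one hf hper] at h
  exact h.trans (by ring)

theorem continuous_pdA {α : R3} {i : Fin 3} {f : R3 → ℂ} (hf : ContDiff ℝ 1 f) :
    Continuous (pdA α i f) := by
  unfold pdA
  exact (continuous_pdC hf).add (continuous_const.mul hf.continuous)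

section Curl

variable {α : R3} {F : R3 → C3} {n : ℤ × ℤ} {t : ℝ}

theorem sqCoeff_curlA_zero (hα : α 2 = 0) (hF : ∀ j, ContDiff ℝ 1 fun y => F y j)
    (hper : ∀ j, Biperiodic fun y => F y j) :
    sqCoeff (fun y => curlA α F y 0) n t
      = Complex.I * ((n.2 : ℂ) + (α 1 : ℂ)) * sqCoeff (fun y => F y 2) n t
        - sqCoeff (pdC 2 fun y => F y 1) n t := by
  simp only [curlA_zero]
  rw [sqCoeff_sub (continuous_pdA (hF 2)) (continuous_pdA (hF 1)),
    sqCoeff_pdA_one (hF 2) (hper 2), pdA_two hα]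

theorem sqCoeff_curlA_one (hα : α 2 = 0) (hF : ∀ j, ContDiff ℝ 1 fun y => F y j)
    (hper : ∀ j, Biperiodic fun y => F y j) :
    sqCoeff (fun y => curlA α F y 1) n t
      = sqCoeff (pdC 2 fun y => F y 0) n t
        - Complex.I * ((n.1 : ℂ) + (α 0 : ℂ)) * sqCoeff (fun y => F y 2) n t := by
  simp only [curlA_one]
  rw [sqCoeff_sub (continuous_pdA (hF 0)) (continuous_pdA (hF 2)),
    sqCoeff_pdA_zero (hF 2) (hper 2), pdA_two hα]

theorem sqCoeff_curlA_two (hF : ∀ j, ContDiff ℝ 1 fun y => F y j)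
    (hper : ∀ j, Biperiodic fun y => F y j) :
    sqCoeff (fun y => curlA α F y 2) n t
      = Complex.I * ((n.1 : ℂ) + (α 0 : ℂ)) * sqCoeff (fun y => F y 1) n t
        - Complex.I * ((n.2 : ℂ) + (α 1 : ℂ)) * sqCoeff (fun y => F y 0) n t := by
  simp only [curlA_two]
  rw [sqCoeff_sub (continuous_pdA (hF 1)) (continuous_pdA (hF 0)),
    sqCoeff_pdA_zero (hF 1) (hper 1), sqCoeff_pdA_one (hF 0) (hper 0)]

theorem contDiff_curlA (hF : ∀ j, ContDiff ℝ 2 fun y => F y j) (j : Fin 3) :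
    ContDiff ℝ 1 fun y => curlA α F y j := by
  fin_cases j
  · simp only [Fin.zero_eta, curlA_zero]
    exact (contDiff_pdA (hF 2)).sub (contDiff_pdA (hF 1))
  · simp only [Fin.mk_one, curlA_one]
    exact (contDiff_pdA (hF 0)).sub (contDiff_pdA (hF 2))
  · simp only [Fin.reduceFinMk, curlA_two]
    exact (contDiff_pdA (hF 1)).sub (contDiff_pdA (hF 0))

theorem Biperiodic.sub {f g : R3 → ℂ} (hf : Biperiodic f) (hg : Biperiodic g) :
    Biperiodic fun x => f x - g x := fun x =>
  ⟨by simp only [(hf x).1, (hg x).1], by simp only [(hf x).2, (hg x).2]⟩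

theorem Biperiodic.add {f g : R3 → ℂ} (hf : Biperiodic f) (hg : Biperiodic g) :
    Biperiodic fun x => f x + g x := fun x =>
  ⟨by simp only [(hf x).1, (hg x).1], by simp only [(hf x).2, (hg x).2]⟩

theorem Biperiodic.mul {f g : R3 → ℂ} (hf : Biperiodic f) (hg : Biperiodic g) :
    Biperiodic fun x => f x * g x := fun x =>
  ⟨by simp only [(hf x).1, (hg x).1], by simp only [(hf x).2, (hg x).2]⟩

theorem Biperiodic.comp {E E' : Type*} {f : R3 → E} (hf : Biperiodic f) (φ : E → E') :
    Biperiodic fun x => φ (f x) := fun x =>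
  ⟨by simp only [(hf x).1], by simp only [(hf x).2]⟩

theorem biperiodic_curlA (hper : ∀ j, Biperiodic fun y => F y j) (j : Fin 3) :
    Biperiodic fun y => curlA α F y j := by
  fin_cases j
  · simp only [Fin.zero_eta, curlA_zero]
    exact (hper 2).pdA.sub (hper 1).pdA
  · simp only [Fin.mk_one, curlA_one]
    exact (hper 0).pdA.sub (hper 2).pdA
  · simp only [Fin.reduceFinMk, curlA_two]
    exact (hper 1).pdA.sub (hper 0).pdA

end Curl

section Solution

variable {h k : ℝ} {α : R3} {εinv : R3 → ℝ} {H : R3 → C3}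

theorem IsHomSol.contDiff_apply (hH : IsHomSol h k α εinv H) (j : Fin 3) :
    ContDiff ℝ 2 fun y => H y j := contDiff_pi.mp hH.smooth j

theorem IsHomSol.contDiff_one_apply (hH : IsHomSol h k α εinv H) (j : Fin 3) :
    ContDiff ℝ 1 fun y => H y j := (hH.contDiff_apply j).of_le (by norm_num)

theorem IsHomSol.biperiodic_apply (hH : IsHomSol h k α εinv H) (j : Fin 3) :
    Biperiodic fun y => H y j := hH.periodic.comp fun v => v j

theorem EpsOK.contDiff_ofReal (hε : EpsOK h εinv) : ContDiff ℝ 1 fun y => (εinv y : ℂ) :=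
  Complex.ofRealCLM.contDiff.comp hε.smooth

theorem EpsOK.contDiff_mul_curlA (hε : EpsOK h εinv) (hH : IsHomSol h k α εinv H) (j : Fin 3) :
    ContDiff ℝ 1 fun y => ((εinv y : ℂ) • curlA α H y) j :=
  hε.contDiff_ofReal.mul (contDiff_curlA hH.contDiff_apply j)

theorem EpsOK.biperiodic_mul_curlA (hε : EpsOK h εinv) (hH : IsHomSol h k α εinv H) (j : Fin 3) :
    Biperiodic fun y => ((εinv y : ℂ) • curlA α H y) j :=
  (hε.periodic.comp fun r => (r : ℂ)).mul (biperiodic_curlA hH.biperiodic_apply j)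

theorem bpt_mem_Omg {p : ℝ × ℝ} (hp : p ∈ sq2) {t : ℝ} (ht : t ∈ Set.Ioo 0 h) :
    bpt p t ∈ Omg h := ⟨hp.1, hp.2, ht⟩

theorem IsHomSol.sqCoeff_div (hH : IsHomSol h k α εinv H) (hα : α 2 = 0) (n : ℤ × ℤ) {t : ℝ}
    (ht : t ∈ Set.Ioo 0 h) :
    Complex.I * ((n.1 : ℂ) + (α 0 : ℂ)) * sqCoeff (fun y => H y 0) n t
      + Complex.I * ((n.2 : ℂ) + (α 1 : ℂ)) * sqCoeff (fun y => H y 1) n t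
      + sqCoeff (pdC 2 fun y => H y 2) n t = 0 := by
  have hc := hH.contDiff_one_apply
  have hp := hH.biperiodic_apply
  rw [← sqCoeff_pdA_zero (hc 0) (hp 0), ← sqCoeff_pdA_one (hc 1) (hp 1), ← pdA_two hα,
    ← sqCoeff_add (continuous_pdA (hc 0)) (continuous_pdA (hc 1)),
    ← sqCoeff_add (f := fun x => pdA α 0 (fun y => H y 0) x + pdA α 1 (fun y => H y 1) x)
      ((continuous_pdA (hc 0)).add (continuous_pdA (hc 1))) (continuous_pdA (hc 2))]
  have h0 : sqCoeff (fun _ => 0) n t = 0 := by simp [sqCoeff]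
  rw [← h0]
  refine sqCoeff_congr (fun p hpm => ?_) n
  rw [← hH.divfree _ (bpt_mem_Omg hpm ht), divA_eq]

theorem IsHomSol.sqCoeff_div_top (hH : IsHomSol h k α εinv H) (hh : 0 < h) (hα : α 2 = 0)
    (n : ℤ × ℤ) :
    Complex.I * ((n.1 : ℂ) + (α 0 : ℂ)) * sqCoeff (fun y => H y 0) n h
      + Complex.I * ((n.2 : ℂ) + (α 1 : ℂ)) * sqCoeff (fun y => H y 1) n h
      + sqCoeff (pdC 2 fun y => H y 2) n h = 0 := by
  have hcont : ∀ {f : R3 → ℂ}, ContDiff ℝ 1 f → Continuous (sqCoeff f n) := fun hf =>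
    continuous_iff_continuousAt.mpr fun s => (hasDerivAt_sqCoeff hf n s).continuousAt
  have h0 := hcont (hH.contDiff_one_apply 0)
  have h1 := hcont (hH.contDiff_one_apply 1)
  have h2 := hcont (contDiff_one_pdC (i := 2) (hH.contDiff_apply 2))
  have hcl : IsClosed {t : ℝ | Complex.I * ((n.1 : ℂ) + (α 0 : ℂ)) * sqCoeff (fun y => H y 0) n t
      + Complex.I * ((n.2 : ℂ) + (α 1 : ℂ)) * sqCoeff (fun y => H y 1) n t
      + sqCoeff (pdC 2 fun y => H y 2) n t = 0} :=
    isClosed_eq (by fun_prop) continuous_const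
  have hsub := hcl.closure_subset_iff.mpr (fun t (ht : t ∈ Set.Ioo 0 h) => hH.sqCoeff_div hα n ht)
  rw [closure_Ioo hh.ne] at hsub
  exact hsub ⟨hh.le, le_rfl⟩

/-- Near the top, the Fourier coefficients solve the Helmholtz mode equation. -/
theorem IsHomSol.hasDerivAt_mode (hH : IsHomSol h k α εinv H) (hε : EpsOK h εinv)
    (hα : α 2 = 0) {η : ℝ} (hηh : η < h) (hone : ∀ x : R3, h - η < x 2 → εinv x = 1)
    (n : ℤ × ℤ) (j : Fin 3) {t : ℝ} (ht : t ∈ Set.Ioo (h - η) h) :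
    HasDerivAt (sqCoeff (pdC 2 fun y => H y j) n)
      (-betaN k α n ^ 2 * sqCoeff (fun y => H y j) n t) t := by
  have hIoo : ∀ᶠ s in nhds t, s ∈ Set.Ioo (h - η) h := Ioo_mem_nhds ht.1 ht.2
  have hpos : ∀ s ∈ Set.Ioo (h - η) h, s ∈ Set.Ioo 0 h := fun s hs => ⟨by linarith [hs.1], hs.2⟩
  have hc := hH.contDiff_one_apply
  have hp := hH.biperiodic_apply
  have hEc := hε.contDiff_mul_curlA hH
  have hEp := hε.biperiodic_mul_curlA hH
  have hE : ∀ s ∈ Set.Ioo (h - η) h, ∀ i, sqCoeff (fun y => ((εinv y : ℂ) • curlA α H y) i) n s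
      = sqCoeff (fun y => curlA α H y i) n s := by
    intro s hs i
    refine sqCoeff_congr (fun p _ => ?_) n
    have : εinv (bpt p s) = 1 := hone _ (by simpa [bpt] using hs.1)
    simp [this]
  have hM : ∀ i, sqCoeff (fun y => curlA α (fun y => (εinv y : ℂ) • curlA α H y) y i) n t
      = (k : ℂ) ^ 2 * sqCoeff (fun y => H y i) n t := by
    intro i
    rw [← sqCoeff_const_mul]
    refine sqCoeff_congr (fun p hpm => ?_) n
    rw [hH.maxwell _ (bpt_mem_Omg hpm (hpos t ht))]
    simp
  have hu := fun i => hasDerivAt_sqCoeff (hc i) n t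
  have he := fun i => hasDerivAt_sqCoeff (hEc i) n t
  have hdiv := hH.sqCoeff_div hα n (hpos t ht)
  have hb := betaN_sq k α n
  have m0 := hM 0
  have m1 := hM 1
  have m2 := hM 2
  rw [sqCoeff_curlA_zero hα hEc hEp] at m0
  rw [sqCoeff_curlA_one hα hEc hEp] at m1
  rw [sqCoeff_curlA_two hEc hEp, hE t ht, hE t ht, sqCoeff_curlA_zero hα hc hp,
    sqCoeff_curlA_one hα hc hp] at m2
  rw [hE t ht, sqCoeff_curlA_two hc hp] at m0 m1
  fin_cases j
  · have hev : sqCoeff (pdC 2 fun y => H y 0) n =ᶠ[nhds t] fun s =>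
        sqCoeff (fun y => ((εinv y : ℂ) • curlA α H y) 1) n s
          + Complex.I * ((n.1 : ℂ) + (α 0 : ℂ)) * sqCoeff (fun y => H y 2) n s := by
      filter_upwards [hIoo] with s hs
      rw [hE s hs, sqCoeff_curlA_one hα hc hp]
      ring
    refine (((he 1).add ((hu 2).const_mul _)).congr_of_eventuallyEq hev).congr_deriv ?_
    simp only [Fin.zero_eta]
    rw [hb]
    linear_combination -m0 + Complex.I * ((n.1 : ℂ) + (α 0 : ℂ)) * hdiv
      - ((n.1 + α 0) ^ 2 + (n.2 + α 1) ^ 2) * sqCoeff (fun y => H y 0) n t * Complex.I_sq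
  · have hev : sqCoeff (pdC 2 fun y => H y 1) n =ᶠ[nhds t] fun s =>
        Complex.I * ((n.2 : ℂ) + (α 1 : ℂ)) * sqCoeff (fun y => H y 2) n s
          - sqCoeff (fun y => ((εinv y : ℂ) • curlA α H y) 0) n s := by
      filter_upwards [hIoo] with s hs
      rw [hE s hs, sqCoeff_curlA_zero hα hc hp]
      ring
    refine ((((hu 2).const_mul _).sub (he 0)).congr_of_eventuallyEq hev).congr_deriv ?_
    simp only [Fin.mk_one]
    rw [hb]
    linear_combination -m1 + Complex.I * ((n.2 : ℂ) + (α 1 : ℂ)) * hdiv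
      - ((n.1 + α 0) ^ 2 + (n.2 + α 1) ^ 2) * sqCoeff (fun y => H y 1) n t * Complex.I_sq
  · have hev : sqCoeff (pdC 2 fun y => H y 2) n =ᶠ[nhds t] fun s =>
        -(Complex.I * ((n.1 : ℂ) + (α 0 : ℂ)) * sqCoeff (fun y => H y 0) n s
          + Complex.I * ((n.2 : ℂ) + (α 1 : ℂ)) * sqCoeff (fun y => H y 1) n s) := by
      filter_upwards [hIoo] with s hs
      linear_combination hH.sqCoeff_div hα n (hpos s hs)
    refine ((((hu 0).const_mul _).add ((hu 1).const_mul _)).neg.congr_of_eventuallyEq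
      hev).congr_deriv ?_
    simp only [Fin.reduceFinMk]
    rw [hb]
    linear_combination -m2
      - ((n.1 + α 0) ^ 2 + (n.2 + α 1) ^ 2) * sqCoeff (fun y => H y 2) n t * Complex.I_sq

end Solution

section Radiation

variable {h k : ℝ} {α : R3} {εinv : R3 → ℝ} {H : R3 → C3}

theorem IsHomSol.sqCoeff_radiation (hH : IsHomSol h k α εinv H) (n : ℤ × ℤ) (j : Fin 3) :
    sqCoeff (pdC 2 fun y => H y j) n h
      = Complex.I * betaN k α n * sqCoeff (fun y => H y j) n h := by
  rw [← (hasDerivAt_sqCoeff (hH.contDiff_one_apply j) n h).deriv]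
  exact hH.radiation n j

/-- Below `Γ_h` but above the support of `1 - ε_r⁻¹`, every Fourier mode is outgoing. -/
theorem IsHomSol.exists_outgoing (hH : IsHomSol h k α εinv H) (hε : EpsOK h εinv)
    (hα : α 2 = 0) : ∃ t₀ < h, ∀ n j,
      sqCoeff (fun y => H y j) n h
        = Complex.exp (Complex.I * betaN k α n * (h - t₀ : ℝ)) * sqCoeff (fun y => H y j) n t₀ ∧
      sqCoeff (pdC 2 fun y => H y j) n t₀
        = Complex.I * betaN k α n * sqCoeff (fun y => H y j) n t₀ := by
  obtain ⟨η, hη, hηh, hone⟩ := hε.one_near_top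
  have hmem : ∀ t ∈ Set.Ico (h - η / 2) h, t ∈ Set.Ioo (h - η) h := fun t ht =>
    ⟨by linarith [ht.1], ht.2⟩
  refine ⟨h - η / 2, by linarith, fun n j => ?_⟩
  have hu := hasDerivAt_sqCoeff (hH.contDiff_one_apply j) n
  have hv := hasDerivAt_sqCoeff (contDiff_one_pdC (i := 2) (hH.contDiff_apply j)) n
  have hout := outgoing_of_hasDerivAt hu
    (continuous_iff_continuousAt.mpr fun s => (hv s).continuousAt)
    (fun t ht => hH.hasDerivAt_mode hε hα hηh hone n j ht) (hH.sqCoeff_radiation n j)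
  refine ⟨?_, hout _ (hmem _ ⟨le_rfl, by linarith⟩)⟩
  refine eq_mul_exp_of_hasDerivAt (by linarith)
    (continuous_iff_continuousAt.mpr fun s => (hu s).continuousAt).continuousOn fun t ht => ?_
  rw [← hout t (hmem t ht)]
  exact hu t

theorem summable_norm_sqCoeff (hk : 0 < k) {f : R3 → ℂ} (hf : Continuous f) {t₀ : ℝ}
    (ht : t₀ < h)
    (hexp : ∀ n, sqCoeff f n h
      = Complex.exp (Complex.I * betaN k α n * (h - t₀ : ℝ)) * sqCoeff f n t₀) :
    Summable fun n => ‖sqCoeff f n h‖ := by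
  obtain ⟨M, hM⟩ := exists_norm_sqCoeff_le hf t₀
  refine Summable.of_nonneg_of_le (fun _ => norm_nonneg _) (fun n => ?_)
    ((summable_exp_neg_betaN_im hk α (sub_pos.mpr ht)).mul_right M)
  rw [hexp, norm_mul, Complex.norm_exp]
  refine mul_le_mul (Real.exp_le_exp.mpr (le_of_eq ?_)) (hM n) (norm_nonneg _)
    (Real.exp_pos _).le
  simp only [Complex.mul_re, Complex.mul_im, Complex.I_re, Complex.I_im, Complex.ofReal_re,
    Complex.ofReal_im]
  ring

theorem IsHomSol.summable_sqCoeff (hH : IsHomSol h k α εinv H) (hε : EpsOK h εinv)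
    (hα : α 2 = 0) (hk : 0 < k) (j : Fin 3) :
    (Summable fun n => ‖sqCoeff (fun y => H y j) n h‖) ∧
    (Summable fun n => ‖sqCoeff (pdC 2 fun y => H y j) n h‖) ∧
    (Summable fun n => ‖sqCoeff (fun y => curlA α H y j) n h‖) := by
  obtain ⟨t₀, ht, hout⟩ := hH.exists_outgoing hε hα
  have hc := hH.contDiff_one_apply
  have hp := hH.biperiodic_apply
  have hv : ∀ j n, sqCoeff (pdC 2 fun y => H y j) n h
      = Complex.exp (Complex.I * betaN k α n * (h - t₀ : ℝ))
        * sqCoeff (pdC 2 fun y => H y j) n t₀ := fun j n => by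
    rw [hH.sqCoeff_radiation, (hout n j).1, (hout n j).2]
    ring
  refine ⟨summable_norm_sqCoeff hk (hc j).continuous ht fun n => (hout n j).1,
    summable_norm_sqCoeff hk (continuous_pdC (hc j)) ht (hv j),
    summable_norm_sqCoeff (α := α) hk (contDiff_curlA hH.contDiff_apply j).continuous ht
      fun n => ?_⟩
  fin_cases j
  · simp only [Fin.zero_eta, sqCoeff_curlA_zero hα hc hp]
    rw [hv, (hout n 2).1]
    ring
  · simp only [Fin.mk_one, sqCoeff_curlA_one hα hc hp]
    rw [hv, (hout n 2).1]
    ring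
  · simp only [Fin.reduceFinMk, sqCoeff_curlA_two hc hp]
    rw [(hout n 0).1, (hout n 1).1]
    ring

/-- The Dirichlet-to-Neumann operator maps a radiating solution to its normal derivative. -/
theorem IsHomSol.talpha_eq (hH : IsHomSol h k α εinv H) (hε : EpsOK h εinv)
    (hα : α 2 = 0) (hk : 0 < k) (j : Fin 3) (p : ℝ × ℝ) :
    Talpha k α H h j p = pdC 2 (fun y => H y j) (bpt p h) := by
  rw [← (hasSum_sqCoeff (continuous_pdC (hH.contDiff_one_apply j)) (hH.biperiodic_apply j).pdC
    (hH.summable_sqCoeff hε hα hk j).2.1 p).tsum_eq]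
  simp only [hH.sqCoeff_radiation]
  rfl

theorem im_mode_flux {β ν₀ ν₁ h₀ h₁ h₂ : ℂ} (hν₀ : (starRingEnd ℂ) ν₀ = ν₀)
    (hν₁ : (starRingEnd ℂ) ν₁ = ν₁)
    (hdiv : Complex.I * ν₀ * h₀ + Complex.I * ν₁ * h₁ + Complex.I * β * h₂ = 0) :
    ((Complex.I * ν₁ * h₂ - Complex.I * β * h₁) * (starRingEnd ℂ) h₁
      - (Complex.I * β * h₀ - Complex.I * ν₀ * h₂) * (starRingEnd ℂ) h₀).im
      = -(β.re * (Complex.normSq h₀ + Complex.normSq h₁ + Complex.normSq h₂)) := by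
  have hd : ν₀ * (starRingEnd ℂ) h₀ + ν₁ * (starRingEnd ℂ) h₁
      + (starRingEnd ℂ) β * (starRingEnd ℂ) h₂ = 0 := by
    have h' := congrArg (starRingEnd ℂ) hdiv
    simp only [map_add, map_mul, hν₀, hν₁, Complex.conj_I, map_zero] at h'
    linear_combination Complex.I * h' + (ν₀ * (starRingEnd ℂ) h₀ + ν₁ * (starRingEnd ℂ) h₁
      + (starRingEnd ℂ) β * (starRingEnd ℂ) h₂) * Complex.I_sq
  have he : (Complex.I * ν₁ * h₂ - Complex.I * β * h₁) * (starRingEnd ℂ) h₁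
      - (Complex.I * β * h₀ - Complex.I * ν₀ * h₂) * (starRingEnd ℂ) h₀
      = Complex.I * (-(β * ((h₀ * (starRingEnd ℂ) h₀) + (h₁ * (starRingEnd ℂ) h₁))
        + (starRingEnd ℂ) β * (h₂ * (starRingEnd ℂ) h₂))) := by
    linear_combination Complex.I * h₂ * hd
  rw [he]
  simp only [Complex.mul_conj, Complex.I_mul_im, Complex.neg_re, Complex.add_re,
    ← Complex.ofReal_add,
    Complex.re_mul_ofReal, Complex.conj_re]
  ring

theorem re_mode_eq_zero {β ν₀ ν₁ κ h₀ h₁ h₂ : ℂ} (hν₀ : (starRingEnd ℂ) ν₀ = ν₀)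
    (hν₁ : (starRingEnd ℂ) ν₁ = ν₁) (hβ : β ^ 2 = κ - (ν₀ ^ 2 + ν₁ ^ 2))
    (hdiv : Complex.I * ν₀ * h₀ + Complex.I * ν₁ * h₁ + Complex.I * β * h₂ = 0)
    (hz : β.re * (Complex.normSq h₀ + Complex.normSq h₁ + Complex.normSq h₂) = 0) :
    (Complex.I * ν₁ * h₂ - Complex.I * β * h₁)
        * (starRingEnd ℂ) (Complex.I * ν₁ * h₂ - Complex.I * β * h₁)
      + (Complex.I * β * h₀ - Complex.I * ν₀ * h₂)
        * (starRingEnd ℂ) (Complex.I * β * h₀ - Complex.I * ν₀ * h₂)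
      + (Complex.I * ν₀ * h₁ - Complex.I * ν₁ * h₀)
        * (starRingEnd ℂ) (Complex.I * ν₀ * h₁ - Complex.I * ν₁ * h₀)
      - κ * (h₀ * (starRingEnd ℂ) h₀ + h₁ * (starRingEnd ℂ) h₁ + h₂ * (starRingEnd ℂ) h₂)
      + 2 * ((Complex.I * ν₁ * h₂ - Complex.I * β * h₁) * (starRingEnd ℂ) (Complex.I * β * h₁)
        - (Complex.I * β * h₀ - Complex.I * ν₀ * h₂) * (starRingEnd ℂ) (Complex.I * β * h₀))
      = 0 := by
  rcases mul_eq_zero.mp hz with hre | hn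
  · have hb : (starRingEnd ℂ) β = -β := by
      apply Complex.ext <;> simp [hre]
    simp only [map_sub, map_mul, hν₀, hν₁, hb, Complex.conj_I]
    linear_combination Complex.I * (β * (starRingEnd ℂ) h₂ + ν₀ * (starRingEnd ℂ) h₀
        + ν₁ * (starRingEnd ℂ) h₁) * hdiv
      + (h₀ * (starRingEnd ℂ) h₀ + h₁ * (starRingEnd ℂ) h₁ + h₂ * (starRingEnd ℂ) h₂)
        * (hβ - (β ^ 2 + ν₀ ^ 2 + ν₁ ^ 2) * Complex.I_sq)
  · have e0 := Complex.normSq_nonneg h₀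
    have e1 := Complex.normSq_nonneg h₁
    have e2 := Complex.normSq_nonneg h₂
    have z0 : h₀ = 0 := Complex.normSq_eq_zero.mp (by linarith)
    have z1 : h₁ = 0 := Complex.normSq_eq_zero.mp (by linarith)
    have z2 : h₂ = 0 := Complex.normSq_eq_zero.mp (by linarith)
    simp [z0, z1, z2]

theorem conj_intCast_add_ofReal (m : ℤ) (a : ℝ) :
    (starRingEnd ℂ) ((m : ℂ) + (a : ℂ)) = (m : ℂ) + (a : ℂ) := by simp

/-- If no energy is radiated, all propagating modes vanish at `Γ_h`. -/
theorem IsHomSol.re_betaN_mul_eq_zero (hH : IsHomSol h k α εinv H) (hε : EpsOK h εinv)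
    (hh : 0 < h) (hα : α 2 = 0) (hk : 0 < k)
    (him : (∫ p in sq2, (curlA α H (bpt p h) 0 * (starRingEnd ℂ) (H (bpt p h) 1)
      - curlA α H (bpt p h) 1 * (starRingEnd ℂ) (H (bpt p h) 0))).im = 0) (n : ℤ × ℤ) :
    (betaN k α n).re * (Complex.normSq (sqCoeff (fun y => H y 0) n h)
      + Complex.normSq (sqCoeff (fun y => H y 1) n h)
      + Complex.normSq (sqCoeff (fun y => H y 2) n h)) = 0 := by
  have hc := hH.contDiff_one_apply
  have hp := hH.biperiodic_apply
  have hC := fun j => (contDiff_curlA (α := α) hH.contDiff_apply j).continuous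
  have hCp := fun j => biperiodic_curlA (α := α) hp j
  have hS := hH.summable_sqCoeff hε hα hk
  have key := (hasSum_sqCoeff_mul_conj (hC 0) (hCp 0) (hc 1).continuous (hS 0).2.2).sub
    (hasSum_sqCoeff_mul_conj (hC 1) (hCp 1) (hc 0).continuous (hS 1).2.2)
  rw [← integral_sub
    (integrableOn_sq2 (g := fun p => curlA α H (bpt p h) 0 * (starRingEnd ℂ) (H (bpt p h) 1))
      ((continuous_comp_bpt (hC 0) h).mul
        (Complex.continuous_conj.comp (continuous_comp_bpt (hc 1).continuous h))))
    (integrableOn_sq2 (g := fun p => curlA α H (bpt p h) 1 * (starRingEnd ℂ) (H (bpt p h) 0))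
      ((continuous_comp_bpt (hC 1) h).mul
        (Complex.continuous_conj.comp (continuous_comp_bpt (hc 0).continuous h))))] at key
  have key := (Complex.hasSum_im key).neg
  rw [him, neg_zero] at key
  have hterm : ∀ m : ℤ × ℤ, -(4 * (π : ℂ) ^ 2 * (sqCoeff (fun y => curlA α H y 0) m h
        * (starRingEnd ℂ) (sqCoeff (fun y => H y 1) m h))
      - 4 * (π : ℂ) ^ 2 * (sqCoeff (fun y => curlA α H y 1) m h
        * (starRingEnd ℂ) (sqCoeff (fun y => H y 0) m h))).im
      = 4 * π ^ 2 * ((betaN k α m).re * (Complex.normSq (sqCoeff (fun y => H y 0) m h)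
      + Complex.normSq (sqCoeff (fun y => H y 1) m h)
      + Complex.normSq (sqCoeff (fun y => H y 2) m h))) := by
    intro m
    have hdiv := hH.sqCoeff_div_top hh hα m
    rw [hH.sqCoeff_radiation] at hdiv
    have hm := im_mode_flux (conj_intCast_add_ofReal m.1 (α 0))
      (conj_intCast_add_ofReal m.2 (α 1)) hdiv
    rw [sqCoeff_curlA_zero hα hc hp, sqCoeff_curlA_one hα hc hp, hH.sqCoeff_radiation,
      hH.sqCoeff_radiation, ← mul_sub]
    have h4 : (4 * (π : ℂ) ^ 2) = ((4 * π ^ 2 : ℝ) : ℂ) := by push_cast; rfl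
    rw [h4, Complex.im_ofReal_mul, hm]
    ring
  have hnn : ∀ m : ℤ × ℤ, 0 ≤ 4 * π ^ 2 * ((betaN k α m).re *
      (Complex.normSq (sqCoeff (fun y => H y 0) m h)
      + Complex.normSq (sqCoeff (fun y => H y 1) m h)
      + Complex.normSq (sqCoeff (fun y => H y 2) m h))) := fun m => by
    have e0 := Complex.normSq_nonneg (sqCoeff (fun y => H y 0) m h)
    have e1 := Complex.normSq_nonneg (sqCoeff (fun y => H y 1) m h)
    have e2 := Complex.normSq_nonneg (sqCoeff (fun y => H y 2) m h)
    have e3 := betaN_re_nonneg k α m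
    positivity
  have key2 := (hasSum_zero_iff_of_nonneg hnn).mp (by simpa only [hterm] using key)
  have := congrFun key2 n
  exact (mul_eq_zero.mp this).resolve_left (by positivity)

theorem IsHomSol.integral_top_eq_zero (hH : IsHomSol h k α εinv H) (hε : EpsOK h εinv)
    (hh : 0 < h) (hα : α 2 = 0) (hk : 0 < k)
    (him : (∫ p in sq2, (curlA α H (bpt p h) 0 * (starRingEnd ℂ) (H (bpt p h) 1)
      - curlA α H (bpt p h) 1 * (starRingEnd ℂ) (H (bpt p h) 0))).im = 0) :
    ∫ p in sq2, (curlA α H (bpt p h) 0 * (starRingEnd ℂ) (curlA α H (bpt p h) 0)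
      + curlA α H (bpt p h) 1 * (starRingEnd ℂ) (curlA α H (bpt p h) 1)
      + curlA α H (bpt p h) 2 * (starRingEnd ℂ) (curlA α H (bpt p h) 2)
      - (k : ℂ) ^ 2 * (H (bpt p h) 0 * (starRingEnd ℂ) (H (bpt p h) 0)
        + H (bpt p h) 1 * (starRingEnd ℂ) (H (bpt p h) 1)
        + H (bpt p h) 2 * (starRingEnd ℂ) (H (bpt p h) 2))
      + 2 * (curlA α H (bpt p h) 0 * (starRingEnd ℂ) (pdC 2 (fun y => H y 1) (bpt p h))
        - curlA α H (bpt p h) 1 * (starRingEnd ℂ) (pdC 2 (fun y => H y 0) (bpt p h)))) = 0 := by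
  have hc := hH.contDiff_one_apply
  have hp := hH.biperiodic_apply
  have hC := fun j => (contDiff_curlA (α := α) hH.contDiff_apply j).continuous
  have hCp := fun j => biperiodic_curlA (α := α) hp j
  have hV := fun j => continuous_pdC (i := 2) (hc j)
  have hS := hH.summable_sqCoeff hε hα hk
  have hint : ∀ {f g : R3 → ℂ}, Continuous f → Continuous g →
      IntegrableOn (fun p => f (bpt p h) * (starRingEnd ℂ) (g (bpt p h))) sq2 := fun hf hg =>
    integrableOn_sq2 ((continuous_comp_bpt hf h).mul
      (Complex.continuous_conj.comp (continuous_comp_bpt hg h)))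
  have sC := fun j => hasSum_sqCoeff_mul_conj (hC j) (hCp j) (hC j) (hS j).2.2
  have sH := fun j => hasSum_sqCoeff_mul_conj (hc j).continuous (hp j) (hc j).continuous (hS j).1
  have key := ((((sC 0).add (sC 1)).add (sC 2)).sub
    ((((sH 0).add (sH 1)).add (sH 2)).mul_left ((k : ℂ) ^ 2))).add
    (((hasSum_sqCoeff_mul_conj (hC 0) (hCp 0) (hV 1) (hS 0).2.2).sub
      (hasSum_sqCoeff_mul_conj (hC 1) (hCp 1) (hV 0) (hS 1).2.2)).mul_left 2)
  have iC := fun j => hint (hC j) (hC j)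
  have iH := fun j => hint (hc j).continuous (hc j).continuous
  have i01 := hint (hC 0) (hV 1)
  have i10 := hint (hC 1) (hV 0)
  have iC3 := ((iC 0).add (iC 1)).add (iC 2)
  have iH3 := (((iH 0).add (iH 1)).add (iH 2)).const_mul ((k : ℂ) ^ 2)
  rw [integral_add, integral_sub, integral_add, integral_add, integral_const_mul, integral_add,
    integral_add, integral_const_mul, integral_sub]
  · refine key.unique ?_
    refine hasSum_zero.congr_fun fun n => ?_
    have hdiv := hH.sqCoeff_div_top hh hα n
    rw [hH.sqCoeff_radiation] at hdiv
    have hm := re_mode_eq_zero (conj_intCast_add_ofReal n.1 (α 0))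
      (conj_intCast_add_ofReal n.2 (α 1)) (betaN_sq k α n) hdiv
      (hH.re_betaN_mul_eq_zero hε hh hα hk him n)
    rw [sqCoeff_curlA_zero hα hc hp, sqCoeff_curlA_one hα hc hp, sqCoeff_curlA_two hc hp,
      hH.sqCoeff_radiation, hH.sqCoeff_radiation]
    linear_combination 4 * (π : ℂ) ^ 2 * hm
  all_goals first
    | exact i01 | exact i10 | exact iC 0 | exact iC 1 | exact iC 2 | exact iH 0 | exact iH 1
    | exact iH 2 | exact iH3 | exact iC3 | exact (iC 0).add (iC 1) | exact (iH 0).add (iH 1)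
    | exact iC3.sub iH3 | exact (i01.sub i10).const_mul 2

end Radiation

theorem pdC_const_mul {i : Fin 3} (c : ℂ) {f : R3 → ℂ} {x : R3} (hf : DifferentiableAt ℝ f x) :
    pdC i (fun y => c * f y) x = c * pdC i f x := by
  rw [pdC_mul (f := fun _ => c) (differentiableAt_const c) hf, pdC_const]
  ring

theorem pdA_coord_two_mul {α : R3} {i : Fin 3} {f : R3 → ℂ} {x : R3}
    (hf : DifferentiableAt ℝ f x) :
    pdA α i (fun y => (y 2 : ℂ) * f y) x
      = (if i = 2 then f x else 0) + (x 2 : ℂ) * pdA α i f x := by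
  rw [pdA_ofReal_mul (r := fun y => y 2) (differentiableAt_apply 2 x) hf, pdR_coord]
  split_ifs <;> simp

theorem pdC_dotc (α : R3) {i : Fin 3} {F G : R3 → C3} {x : R3}
    (hF : ∀ j, DifferentiableAt ℝ (fun y => F y j) x)
    (hG : ∀ j, DifferentiableAt ℝ (fun y => G y j) x) :
    pdC i (fun y => dotc (F y) (G y)) x
      = ∑ j, (pdA α i (fun y => F y j) x * (starRingEnd ℂ) (G x j)
        + F x j * (starRingEnd ℂ) (pdA α i (fun y => G y j) x)) := by
  have hd : ∀ j, DifferentiableAt ℝ (fun y => F y j * (starRingEnd ℂ) (G y j)) x := fun j =>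
    (hF j).mul (hG j).star
  simp only [dotc, Fin.sum_univ_three]
  rw [pdC_add (f := fun y => F y 0 * (starRingEnd ℂ) (G y 0) + F y 1 * (starRingEnd ℂ) (G y 1))
    ((hd 0).add (hd 1)) (hd 2), pdC_add (hd 0) (hd 1), pdC_mul_conj α (hF 0) (hG 0),
    pdC_mul_conj α (hF 1) (hG 1), pdC_mul_conj α (hF 2) (hG 2)]

/-- The flux `E × conj G`. -/
def crossFlux (E G : R3 → C3) (i : Fin 3) (y : R3) : ℂ := crossC (E y) (conjV (G y)) i

section Flux

variable {E G : R3 → C3}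

theorem crossFlux_zero :
    crossFlux E G 0 = fun y => E y 1 * (starRingEnd ℂ) (G y 2) - E y 2 * (starRingEnd ℂ) (G y 1) :=
  rfl

theorem crossFlux_one :
    crossFlux E G 1 = fun y => E y 2 * (starRingEnd ℂ) (G y 0) - E y 0 * (starRingEnd ℂ) (G y 2) :=
  rfl

theorem crossFlux_two :
    crossFlux E G 2 = fun y => E y 0 * (starRingEnd ℂ) (G y 1) - E y 1 * (starRingEnd ℂ) (G y 0) :=
  rfl

theorem ContDiff.conj_comp {f : R3 → ℂ} (hf : ContDiff ℝ 1 f) :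
    ContDiff ℝ 1 fun y => (starRingEnd ℂ) (f y) :=
  Complex.conjCLE.contDiff.comp hf

theorem contDiff_crossFlux (hE : ∀ j, ContDiff ℝ 1 fun y => E y j)
    (hG : ∀ j, ContDiff ℝ 1 fun y => G y j) (i : Fin 3) : ContDiff ℝ 1 (crossFlux E G i) := by
  have h : ∀ a b, ContDiff ℝ 1 fun y => E y a * (starRingEnd ℂ) (G y b) := fun a b =>
    (hE a).mul (hG b).conj_comp
  fin_cases i
  · exact (h 1 2).sub (h 2 1)
  · exact (h 2 0).sub (h 0 2)
  · exact (h 0 1).sub (h 1 0)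

theorem biperiodic_crossFlux (hE : ∀ j, Biperiodic fun y => E y j)
    (hG : ∀ j, Biperiodic fun y => G y j) (i : Fin 3) : Biperiodic (crossFlux E G i) := by
  have h : ∀ a b, Biperiodic fun y => E y a * (starRingEnd ℂ) (G y b) := fun a b =>
    (hE a).mul ((hG b).comp (starRingEnd ℂ))
  fin_cases i
  · exact (h 1 2).sub (h 2 1)
  · exact (h 2 0).sub (h 0 2)
  · exact (h 0 1).sub (h 1 0)

/-- `div (E × conj G) = curl_α E · conj G - E · conj (curl_α G)`. -/
theorem sum_pdC_crossFlux (α : R3) {x : R3} (hE : ∀ j, DifferentiableAt ℝ (fun y => E y j) x)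
    (hG : ∀ j, DifferentiableAt ℝ (fun y => G y j) x) :
    ∑ i, pdC i (crossFlux E G i) x
      = dotc (curlA α E x) (G x) - dotc (E x) (curlA α G x) := by
  have hd : ∀ a b, DifferentiableAt ℝ (fun y => E y a * (starRingEnd ℂ) (G y b)) x := fun a b =>
    (hE a).mul (hG b).star
  simp only [Fin.sum_univ_three, crossFlux_zero, crossFlux_one, crossFlux_two, dotc, curlA_zero,
    curlA_one, curlA_two]
  rw [pdC_sub (hd 1 2) (hd 2 1), pdC_sub (hd 2 0) (hd 0 2), pdC_sub (hd 0 1) (hd 1 0),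
    pdC_mul_conj α (hE 1) (hG 2), pdC_mul_conj α (hE 2) (hG 1), pdC_mul_conj α (hE 2) (hG 0),
    pdC_mul_conj α (hE 0) (hG 2), pdC_mul_conj α (hE 0) (hG 1), pdC_mul_conj α (hE 1) (hG 0)]
  simp only [map_sub]
  ring

theorem pdC_two_curlA {α : R3} {F : R3 → C3} (hF : ∀ j, ContDiff ℝ 2 fun y => F y j)
    (j : Fin 3) (x : R3) :
    pdC 2 (fun y => curlA α F y j) x = curlA α (pdV 2 F) x j := by
  have hd : ∀ i j, DifferentiableAt ℝ (pdA α i fun y => F y j) x := fun i j =>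
    (contDiff_pdA (hF j)).differentiable (by norm_num) x
  fin_cases j
  · simp only [Fin.zero_eta, curlA_zero]
    rw [pdC_sub (hd 1 2) (hd 2 1), pdC_two_pdA (hF 2), pdC_two_pdA (hF 1)]
    rfl
  · simp only [Fin.mk_one, curlA_one]
    rw [pdC_sub (hd 2 0) (hd 0 2), pdC_two_pdA (hF 2), pdC_two_pdA (hF 0)]
    rfl
  · simp only [Fin.reduceFinMk, curlA_two]
    rw [pdC_sub (hd 0 1) (hd 1 0), pdC_two_pdA (hF 1), pdC_two_pdA (hF 0)]
    rfl

theorem pdC_two_divA {α : R3} {F : R3 → C3} (hF : ∀ j, ContDiff ℝ 2 fun y => F y j) (x : R3) :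
    pdC 2 (divA α F) x = divA α (pdV 2 F) x := by
  have hd : ∀ i j, DifferentiableAt ℝ (pdA α i fun y => F y j) x := fun i j =>
    (contDiff_pdA (hF j)).differentiable (by norm_num) x
  rw [show divA α F = fun y => pdA α 0 (fun y => F y 0) y + pdA α 1 (fun y => F y 1) y
    + pdA α 2 (fun y => F y 2) y from funext fun y => divA_eq α F y, divA_eq,
    pdC_add (f := fun y => pdA α 0 (fun y => F y 0) y + pdA α 1 (fun y => F y 1) y)
      ((hd 0 0).add (hd 1 1)) (hd 2 2), pdC_add (hd 0 0) (hd 1 1), pdC_two_pdA (hF 0),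
    pdC_two_pdA (hF 1), pdC_two_pdA (hF 2)]
  rfl

end Flux

section Energy

variable {h k : ℝ} {α : R3} {εinv : R3 → ℝ} {H : R3 → C3}

theorem IsHomSol.divA_pdV (hH : IsHomSol h k α εinv H) {x : R3} (hx : x ∈ Omg h) :
    divA α (pdV 2 H) x = 0 := by
  rw [← pdC_two_divA hH.contDiff_apply, pdC]
  have : divA α H =ᶠ[nhds x] fun _ => 0 := by
    filter_upwards [(isOpen_Omg h).mem_nhds hx] with y hy using hH.divfree y hy
  rw [this.fderiv_eq]
  simp

theorem IsHomSol.cross_bottom (hH : IsHomSol h k α εinv H) {x : R3} (hx : x 2 = 0) :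
    ((εinv x : ℂ) • curlA α H x) 0 = 0 ∧ ((εinv x : ℂ) • curlA α H x) 1 = 0 := by
  have hb := hH.bc_tangential x hx
  have h0 := congrFun hb 0
  have h1 := congrFun hb 1
  simp only [crossC, e3] at h0 h1
  simpa [and_comm] using And.intro h0 h1

theorem EpsOK.eq_one_top (hε : EpsOK h εinv) (p : ℝ × ℝ) : εinv (bpt p h) = 1 := by
  obtain ⟨η, hη, -, hone⟩ := hε.one_near_top
  exact hone _ (by simp [bpt, hη])

theorem dotc_self (v : C3) : dotc v v = (nsq v : ℂ) := by
  simp [dotc, nsq, Complex.mul_conj]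

/-- The energy flux through `Γ_h` vanishes. -/
theorem IsHomSol.im_top_eq_zero (hH : IsHomSol h k α εinv H) (hε : EpsOK h εinv) (hh : 0 < h) :
    (∫ p in sq2, (curlA α H (bpt p h) 0 * (starRingEnd ℂ) (H (bpt p h) 1)
      - curlA α H (bpt p h) 1 * (starRingEnd ℂ) (H (bpt p h) 0))).im = 0 := by
  have hc := hH.contDiff_one_apply
  have hE := hε.contDiff_mul_curlA hH
  have key := setIntegral_Omg_div hh (contDiff_crossFlux hE hc)
    (biperiodic_crossFlux (hε.biperiodic_mul_curlA hH) hH.biperiodic_apply)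
  have hbot : ∀ p : ℝ × ℝ, crossFlux (fun y => (εinv y : ℂ) • curlA α H y) H 2 (bpt p 0) = 0 := by
    intro p
    obtain ⟨h0, h1⟩ := hH.cross_bottom (x := bpt p 0) rfl
    rw [crossFlux_two]
    simp only [h0, h1, zero_mul, sub_zero]
  have htop : ∀ p : ℝ × ℝ, crossFlux (fun y => (εinv y : ℂ) • curlA α H y) H 2 (bpt p h)
      = curlA α H (bpt p h) 0 * (starRingEnd ℂ) (H (bpt p h) 1)
      - curlA α H (bpt p h) 1 * (starRingEnd ℂ) (H (bpt p h) 0) := by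
    intro p
    rw [crossFlux_two]
    simp [hε.eq_one_top]
  simp only [hbot, htop, integral_zero, sub_zero] at key
  have hint : ∫ x in Omg h, ∑ i, pdC i (crossFlux (fun y => (εinv y : ℂ) • curlA α H y) H i) x
      = ((∫ x in Omg h, (k ^ 2 * nsq (H x) - εinv x * nsq (curlA α H x)) : ℝ) : ℂ) := by
    rw [← integral_complex_ofReal]
    refine setIntegral_congr_fun (measurableSet_Omg h) fun x hx => ?_
    rw [sum_pdC_crossFlux α (fun j => (hE j).differentiable (by norm_num) x)
      (fun j => (hc j).differentiable (by norm_num) x), hH.maxwell x hx]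
    have hs : ∀ (c : ℂ) (v w : C3), dotc (c • v) w = c * dotc v w := fun c v w => by
      simp only [dotc, Fin.sum_univ_three, Pi.smul_apply, smul_eq_mul]
      ring
    rw [hs, hs, dotc_self, dotc_self]
    push_cast
    rfl
  rw [← key, hint, Complex.ofReal_im]

end Energy

/-- The Rellich flux
`2 x₃ E × conj V + E × conj H - 2 ε_r⁻¹ H₃ conj V + x₃ (E · conj C - k² |H|²) e₃`,
where `C = curl_α H`, `E = ε_r⁻¹ C` and `V = ∂H/∂x₃`. -/
def rellichFlux (k : ℝ) (α : R3) (εinv : R3 → ℝ) (H : R3 → C3) (i : Fin 3) (y : R3) : ℂ :=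
  2 * crossFlux (fun y => (εinv y : ℂ) • curlA α H y) (fun y => (y 2 : ℂ) • pdV 2 H y) i y
    + crossFlux (fun y => (εinv y : ℂ) • curlA α H y) H i y
    - 2 * ((εinv y : ℂ) * H y 2 * (starRingEnd ℂ) (pdV 2 H y i))
    + if i = 2 then (y 2 : ℂ) * (dotc ((εinv y : ℂ) • curlA α H y) (curlA α H y)
        - (k : ℂ) ^ 2 * dotc (H y) (H y)) else 0

section Rellich

variable {h k : ℝ} {α : R3} {εinv : R3 → ℝ} {H : R3 → C3}

theorem contDiff_coord_mul {f : R3 → ℂ} (hf : ContDiff ℝ 1 f) :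
    ContDiff ℝ 1 fun y => (y 2 : ℂ) * f y :=
  (Complex.ofRealCLM.contDiff.comp (contDiff_apply ℝ ℝ (2 : Fin 3))).mul hf

theorem Biperiodic.coord_mul {f : R3 → ℂ} (hf : Biperiodic f) :
    Biperiodic fun y => (y 2 : ℂ) * f y := fun x =>
  ⟨by simp only [(hf x).1]; simp, by simp only [(hf x).2]; simp⟩

theorem contDiff_dotc {F G : R3 → C3} (hF : ∀ j, ContDiff ℝ 1 fun y => F y j)
    (hG : ∀ j, ContDiff ℝ 1 fun y => G y j) : ContDiff ℝ 1 fun y => dotc (F y) (G y) :=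
  ContDiff.sum fun j _ => (hF j).mul (hG j).conj_comp

theorem biperiodic_dotc {F G : R3 → C3} (hF : ∀ j, Biperiodic fun y => F y j)
    (hG : ∀ j, Biperiodic fun y => G y j) : Biperiodic fun y => dotc (F y) (G y) := by
  simp only [dotc, Fin.sum_univ_three]
  exact (((hF 0).mul ((hG 0).comp _)).add ((hF 1).mul ((hG 1).comp _))).add
    ((hF 2).mul ((hG 2).comp _))

theorem contDiff_rellichFlux (hε : EpsOK h εinv) (hH : IsHomSol h k α εinv H) (i : Fin 3) :
    ContDiff ℝ 1 (rellichFlux k α εinv H i) := by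
  have hc := hH.contDiff_one_apply
  have hE := hε.contDiff_mul_curlA hH
  have hV : ∀ j, ContDiff ℝ 1 fun y => pdV 2 H y j := fun j =>
    contDiff_one_pdC (hH.contDiff_apply j)
  have h4 : ContDiff ℝ 1 fun y : R3 => if i = 2 then (y 2 : ℂ) *
      (dotc ((εinv y : ℂ) • curlA α H y) (curlA α H y) - (k : ℂ) ^ 2 * dotc (H y) (H y))
      else 0 := by
    split_ifs
    · exact contDiff_coord_mul ((contDiff_dotc hE (contDiff_curlA hH.contDiff_apply)).sub
        (contDiff_const.mul (contDiff_dotc hc hc)))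
    · exact contDiff_const
  exact (((contDiff_const.mul (contDiff_crossFlux hE (fun j => contDiff_coord_mul (hV j)) i)).add
    (contDiff_crossFlux hE hc i)).sub
    (contDiff_const.mul ((hε.contDiff_ofReal.mul (hc 2)).mul (hV i).conj_comp))).add h4

theorem biperiodic_rellichFlux (hε : EpsOK h εinv) (hH : IsHomSol h k α εinv H) (i : Fin 3) :
    Biperiodic (rellichFlux k α εinv H i) := by
  have hp := hH.biperiodic_apply
  have hE := hε.biperiodic_mul_curlA hH
  have hV : ∀ j, Biperiodic fun y => pdV 2 H y j := fun j => (hp j).pdC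
  have h4 : Biperiodic fun y : R3 => if i = 2 then (y 2 : ℂ) *
      (dotc ((εinv y : ℂ) • curlA α H y) (curlA α H y) - (k : ℂ) ^ 2 * dotc (H y) (H y))
      else 0 := by
    split_ifs
    · exact ((biperiodic_dotc hE (biperiodic_curlA hp)).sub
        ((biperiodic_dotc hp hp).comp fun z => (k : ℂ) ^ 2 * z)).coord_mul
    · exact fun _ => ⟨rfl, rfl⟩
  exact ((((biperiodic_crossFlux hE (fun j => (hV j).coord_mul) i).comp fun z => 2 * z).add
    (biperiodic_crossFlux hE hp i)).sub
    ((((hε.periodic.comp fun r => (r : ℂ)).mul (hp 2)).mul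
      ((hV i).comp (starRingEnd ℂ))).comp fun z => 2 * z)).add h4

theorem sum_pdC_rellichFlux (hε : EpsOK h εinv) (hH : IsHomSol h k α εinv H) (x : R3) :
    ∑ i, pdC i (rellichFlux k α εinv H i) x
      = 2 * ∑ i, pdC i (crossFlux (fun y => (εinv y : ℂ) • curlA α H y)
          (fun y => (y 2 : ℂ) • pdV 2 H y) i) x
        + ∑ i, pdC i (crossFlux (fun y => (εinv y : ℂ) • curlA α H y) H i) x
        - 2 * ∑ i, (((pdR i εinv x : ℂ) * H x 2 + (εinv x : ℂ) * pdA α i (fun y => H y 2) x)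
            * (starRingEnd ℂ) (pdV 2 H x i)
          + (εinv x : ℂ) * H x 2 * (starRingEnd ℂ) (pdA α i (fun y => pdV 2 H y i) x))
        + (dotc ((εinv x : ℂ) • curlA α H x) (curlA α H x) - (k : ℂ) ^ 2 * dotc (H x) (H x)
          + (x 2 : ℂ) * (pdC 2 (fun y => dotc ((εinv y : ℂ) • curlA α H y) (curlA α H y)) x
            - (k : ℂ) ^ 2 * pdC 2 (fun y => dotc (H y) (H y)) x)) := by
  have hc := hH.contDiff_one_apply
  have hE := hε.contDiff_mul_curlA hH
  have hV : ∀ j, ContDiff ℝ 1 fun y => pdV 2 H y j := fun j =>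
    contDiff_one_pdC (hH.contDiff_apply j)
  have hXV : ∀ j, ContDiff ℝ 1 fun y => ((y 2 : ℂ) • pdV 2 H y) j := fun j =>
    contDiff_coord_mul (hV j)
  have hd : ∀ {f : R3 → ℂ}, ContDiff ℝ 1 f → DifferentiableAt ℝ f x := fun hf =>
    hf.differentiable (by norm_num) x
  have hdE := contDiff_dotc hE (contDiff_curlA hH.contDiff_apply (α := α))
  have hdH := contDiff_dotc hc hc
  have hdS := hdE.sub (contDiff_const (c := (k : ℂ) ^ 2).mul hdH)
  have h4 : ∀ i : Fin 3, ContDiff ℝ 1 fun y : R3 => if i = 2 then (y 2 : ℂ) *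
      (dotc ((εinv y : ℂ) • curlA α H y) (curlA α H y) - (k : ℂ) ^ 2 * dotc (H y) (H y))
      else 0 := by
    intro i
    split_ifs
    · exact contDiff_coord_mul hdS
    · exact contDiff_const
  have htail : ∀ i : Fin 3, pdC i (fun y : R3 => if i = 2 then (y 2 : ℂ) *
      (dotc ((εinv y : ℂ) • curlA α H y) (curlA α H y) - (k : ℂ) ^ 2 * dotc (H y) (H y)) else 0) x
      = if i = 2 then dotc ((εinv x : ℂ) • curlA α H x) (curlA α H x)
          - (k : ℂ) ^ 2 * dotc (H x) (H x)
          + (x 2 : ℂ) * (pdC 2 (fun y => dotc ((εinv y : ℂ) • curlA α H y) (curlA α H y)) x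
            - (k : ℂ) ^ 2 * pdC 2 (fun y => dotc (H y) (H y)) x) else 0 := by
    intro i
    split_ifs with hi
    · subst hi
      rw [pdC_mul (f := fun y : R3 => (y 2 : ℂ)) (hd (Complex.ofRealCLM.contDiff.comp
        (contDiff_apply ℝ ℝ (2 : Fin 3)))) (hd hdS), pdC_ofReal (r := fun y => y 2)
        (differentiableAt_apply 2 x), pdR_coord, pdC_sub (hd hdE)
        (hd (contDiff_const.mul hdH)), pdC_const_mul _ (hd hdH)]
      simp
    · exact pdC_const
  have hG := contDiff_crossFlux hE hXV
  have hK := contDiff_crossFlux hE hc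
  have hεH := hε.contDiff_ofReal.mul (hc 2)
  have hL := fun i => hεH.mul (hV i).conj_comp
  have hi : ∀ i, pdC i (rellichFlux k α εinv H i) x
      = 2 * pdC i (crossFlux (fun y => (εinv y : ℂ) • curlA α H y)
          (fun y => (y 2 : ℂ) • pdV 2 H y) i) x
        + pdC i (crossFlux (fun y => (εinv y : ℂ) • curlA α H y) H i) x
        - 2 * (((pdR i εinv x : ℂ) * H x 2 + (εinv x : ℂ) * pdA α i (fun y => H y 2) x)
            * (starRingEnd ℂ) (pdV 2 H x i)
          + (εinv x : ℂ) * H x 2 * (starRingEnd ℂ) (pdA α i (fun y => pdV 2 H y i) x))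
        + if i = 2 then dotc ((εinv x : ℂ) • curlA α H x) (curlA α H x)
          - (k : ℂ) ^ 2 * dotc (H x) (H x)
          + (x 2 : ℂ) * (pdC 2 (fun y => dotc ((εinv y : ℂ) • curlA α H y) (curlA α H y)) x
            - (k : ℂ) ^ 2 * pdC 2 (fun y => dotc (H y) (H y)) x) else 0 := by
    intro i
    rw [show rellichFlux k α εinv H i = fun y => rellichFlux k α εinv H i y from rfl]
    simp only [rellichFlux]
    have hGK := (contDiff_const (c := (2 : ℂ)).mul (hG i)).add (hK i)
    rw [pdC_add (hd (hGK.sub (contDiff_const.mul (hL i)))) (hd (h4 i)),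
      pdC_sub (hd hGK) (hd (contDiff_const.mul (hL i))),
      pdC_add (hd (contDiff_const.mul (hG i))) (hd (hK i)), pdC_const_mul _ (hd (hG i)),
      pdC_const_mul _ (hd (hL i)), htail,
      pdC_mul_conj α (hd hεH) (hd (hV i)),
      pdA_ofReal_mul (hε.smooth.differentiable (by norm_num) x) (hd (hc 2))]
  simp only [hi, Fin.sum_univ_three]
  simp
  ring

theorem IsHomSol.re_sum_pdC_rellichFlux (hH : IsHomSol h k α εinv H) (hε : EpsOK h εinv)
    (hα : α 2 = 0) {x : R3} (hx : x ∈ Omg h) :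
    (∑ i, pdC i (rellichFlux k α εinv H i) x).re
      = -(2 * εinv x * nsq (pdV 2 H x)
        - x 2 * pdR 2 εinv x * nsq (curlA α H x)
        + 2 * ((((pdR 0 εinv x : ℂ) * pdV 2 H x 0 + (pdR 1 εinv x : ℂ) * pdV 2 H x 1
            + (pdR 2 εinv x : ℂ) * pdV 2 H x 2) * (starRingEnd ℂ) (H x 2)).re)) := by
  have hc := hH.contDiff_one_apply
  have hE := hε.contDiff_mul_curlA hH
  have hC := contDiff_curlA hH.contDiff_apply (α := α)
  have hV : ∀ j, ContDiff ℝ 1 fun y => pdV 2 H y j := fun j =>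
    contDiff_one_pdC (hH.contDiff_apply j)
  have hXV : ∀ j, ContDiff ℝ 1 fun y => ((y 2 : ℂ) • pdV 2 H y) j := fun j =>
    contDiff_coord_mul (hV j)
  have hd : ∀ {f : R3 → ℂ}, ContDiff ℝ 1 f → DifferentiableAt ℝ f x := fun hf =>
    hf.differentiable (by norm_num) x
  have hG : ∀ j i, pdA α i (fun y => ((y 2 : ℂ) • pdV 2 H y) j) x
      = (if i = 2 then pdV 2 H x j else 0) + (x 2 : ℂ) * pdA α i (fun y => pdV 2 H y j) x :=
    fun j i => pdA_coord_two_mul (hd (hV j))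
  have hG0 : curlA α (fun y => (y 2 : ℂ) • pdV 2 H y) x 0
      = (x 2 : ℂ) * curlA α (pdV 2 H) x 0 - pdV 2 H x 1 := by
    rw [curlA_zero, curlA_zero, hG, hG]
    simp
    ring
  have hG1 : curlA α (fun y => (y 2 : ℂ) • pdV 2 H y) x 1
      = (x 2 : ℂ) * curlA α (pdV 2 H) x 1 + pdV 2 H x 0 := by
    rw [curlA_one, curlA_one, hG, hG]
    simp
    ring
  have hG2 : curlA α (fun y => (y 2 : ℂ) • pdV 2 H y) x 2
      = (x 2 : ℂ) * curlA α (pdV 2 H) x 2 := by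
    rw [curlA_two, curlA_two, hG, hG]
    simp
    ring
  have hC2 : ∀ j, pdA α 2 (fun y => curlA α H y j) x = curlA α (pdV 2 H) x j := fun j => by
    rw [pdA_two hα, pdC_two_curlA hH.contDiff_apply]
  have hE2 : ∀ j, pdA α 2 (fun y => (εinv y : ℂ) * curlA α H y j) x
      = (pdR 2 εinv x : ℂ) * curlA α H x j + (εinv x : ℂ) * curlA α (pdV 2 H) x j := fun j => by
    rw [← hC2]
    exact pdA_ofReal_mul (hε.smooth.differentiable (by norm_num) x) (hd (hC j))
  have hH2 : ∀ j, pdA α 2 (fun y => H y j) x = pdV 2 H x j := fun j => by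
    rw [pdA_two hα]
    rfl
  have hdiv := hH.divA_pdV hx
  rw [divA_eq] at hdiv
  have hdivc := congrArg (starRingEnd ℂ) hdiv
  have hC0 := curlA_zero α H x
  have hC1 := curlA_one α H x
  rw [hH2] at hC0 hC1
  have hC0c := congrArg (starRingEnd ℂ) hC0
  have hC1c := congrArg (starRingEnd ℂ) hC1
  apply Complex.ofReal_injective
  have hre : ∀ z : ℂ, ((z.re : ℝ) : ℂ) = (z + (starRingEnd ℂ) z) / 2 := fun z =>
    Complex.re_eq_add_conj z
  rw [hre, sum_pdC_rellichFlux hε hH, sum_pdC_crossFlux α (fun j => hd (hE j))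
    (fun j => hd (hXV j)), sum_pdC_crossFlux α (fun j => hd (hE j))
    (fun j => hd (hc j)), hH.maxwell x hx, pdC_dotc α (fun j => hd (hE j)) (fun j => hd (hC j)),
    pdC_dotc α (fun j => hd (hc j)) (fun j => hd (hc j))]
  push_cast
  rw [hre, ← dotc_self, ← dotc_self]
  simp only [dotc, Fin.sum_univ_three, hG0, hG1, hG2, hC2, hE2, hH2, Pi.smul_apply, smul_eq_mul,
    map_add, map_sub, map_mul, map_pow, Complex.conj_ofReal, Complex.conj_conj, map_zero,
    map_ofNat] at hdivc hC0c hC1c ⊢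
  linear_combination (εinv x : ℂ) * ((starRingEnd ℂ) (pdV 2 H x 1) * hC0
    - (starRingEnd ℂ) (pdV 2 H x 0) * hC1 + pdV 2 H x 1 * hC0c - pdV 2 H x 0 * hC1c
    - H x 2 * hdivc - (starRingEnd ℂ) (H x 2) * hdiv)

theorem rellichFlux_two_bottom (hH : IsHomSol h k α εinv H) (p : ℝ × ℝ) :
    rellichFlux k α εinv H 2 (bpt p 0) = 0 := by
  obtain ⟨h0, h1⟩ := hH.cross_bottom (x := bpt p 0) rfl
  have h2 := hH.bc_normal (bpt p 0) rfl
  have hz : (bpt p 0) 2 = 0 := rfl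
  simp only [rellichFlux, crossFlux_two, h0, h1, h2, hz, zero_mul, mul_zero, sub_zero, add_zero,
    if_true, Complex.ofReal_zero]

theorem rellichFlux_two_top (hε : EpsOK h εinv) (p : ℝ × ℝ) :
    rellichFlux k α εinv H 2 (bpt p h)
      = (h : ℂ) * (curlA α H (bpt p h) 0 * (starRingEnd ℂ) (curlA α H (bpt p h) 0)
      + curlA α H (bpt p h) 1 * (starRingEnd ℂ) (curlA α H (bpt p h) 1)
      + curlA α H (bpt p h) 2 * (starRingEnd ℂ) (curlA α H (bpt p h) 2)
      - (k : ℂ) ^ 2 * (H (bpt p h) 0 * (starRingEnd ℂ) (H (bpt p h) 0)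
        + H (bpt p h) 1 * (starRingEnd ℂ) (H (bpt p h) 1)
        + H (bpt p h) 2 * (starRingEnd ℂ) (H (bpt p h) 2))
      + 2 * (curlA α H (bpt p h) 0 * (starRingEnd ℂ) (pdC 2 (fun y => H y 1) (bpt p h))
        - curlA α H (bpt p h) 1 * (starRingEnd ℂ) (pdC 2 (fun y => H y 0) (bpt p h))))
      + (curlA α H (bpt p h) 0 * (starRingEnd ℂ) (H (bpt p h) 1)
        - curlA α H (bpt p h) 1 * (starRingEnd ℂ) (H (bpt p h) 0))
      - 2 * (starRingEnd ℂ) (pdC 2 (fun y => H y 2) (bpt p h)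
        * (starRingEnd ℂ) (H (bpt p h) 2)) := by
  have hz : (bpt p h) 2 = h := rfl
  simp only [rellichFlux, crossFlux_two, hε.eq_one_top, hz, dotc, Fin.sum_univ_three, pdV,
    Pi.smul_apply, smul_eq_mul, map_mul, Complex.conj_ofReal, Complex.conj_conj, if_true,
    Complex.ofReal_one]
  ring

theorem setIntegral_sq2_combination {u v w : ℝ × ℝ → ℂ} (a b : ℂ) (hu : Continuous u)
    (hv : Continuous v) (hw : Continuous w) :
    ∫ p in sq2, (a * u p + v p - b * (starRingEnd ℂ) (w p))
      = a * (∫ p in sq2, u p) + (∫ p in sq2, v p)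
        - b * (starRingEnd ℂ) (∫ p in sq2, w p) := by
  have hu' := integrableOn_sq2 (g := fun p => a * u p) (continuous_const.mul hu)
  have hv' := integrableOn_sq2 hv
  have hw' := integrableOn_sq2 (g := fun p => b * (starRingEnd ℂ) (w p))
    (continuous_const.mul (Complex.continuous_conj.comp hw))
  have huv := integrableOn_sq2 (g := fun p => a * u p + v p) ((continuous_const.mul hu).add hv)
  rw [integral_sub huv hw', integral_add hu' hv', integral_const_mul, integral_const_mul,
    integral_conj]

theorem IsHomSol.integral_rellichFlux_top (hH : IsHomSol h k α εinv H) (hε : EpsOK h εinv)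
    (hh : 0 < h) (hα : α 2 = 0) (hk : 0 < k) :
    ∫ p in sq2, rellichFlux k α εinv H 2 (bpt p h)
      = (∫ p in sq2, (curlA α H (bpt p h) 0 * (starRingEnd ℂ) (H (bpt p h) 1)
          - curlA α H (bpt p h) 1 * (starRingEnd ℂ) (H (bpt p h) 0)))
        - 2 * (starRingEnd ℂ) (∫ p in sq2, pdC 2 (fun y => H y 2) (bpt p h)
          * (starRingEnd ℂ) (H (bpt p h) 2)) := by
  have hc := fun j => (hH.contDiff_one_apply j).continuous
  have hC := fun j => (contDiff_curlA hH.contDiff_apply (α := α) j).continuous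
  have hD := fun j => continuous_pdC (i := 2) (hH.contDiff_one_apply j)
  have hcb := fun j => continuous_comp_bpt (hc j) h
  have hCb := fun j => continuous_comp_bpt (hC j) h
  have hDb := fun j => continuous_comp_bpt (hD j) h
  have hj : ∀ {f : ℝ × ℝ → ℂ}, Continuous f → Continuous fun p => (starRingEnd ℂ) (f p) :=
    fun hf => Complex.continuous_conj.comp hf
  simp only [rellichFlux_two_top hε]
  refine (setIntegral_sq2_combination _ _ ?_ ?_ ?_).trans ?_
  · exact (((((hCb 0).mul (hj (hCb 0))).add ((hCb 1).mul (hj (hCb 1)))).add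
      ((hCb 2).mul (hj (hCb 2)))).sub (continuous_const.mul
      ((((hcb 0).mul (hj (hcb 0))).add ((hcb 1).mul (hj (hcb 1)))).add
        ((hcb 2).mul (hj (hcb 2)))))).add (continuous_const.mul
      (((hCb 0).mul (hj (hDb 1))).sub ((hCb 1).mul (hj (hDb 0)))))
  · exact ((hCb 0).mul (hj (hcb 1))).sub ((hCb 1).mul (hj (hcb 0)))
  · exact (hDb 2).mul (hj (hcb 2))
  · rw [hH.integral_top_eq_zero hε hh hα hk (hH.im_top_eq_zero hε hh), mul_zero, zero_add]

end Rellich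

/-- **Rellich identity.** Every homogeneous radiating solution `H` satisfies
`∫_Ω [2 ε_r⁻¹ |∂H/∂x₃|² − x₃ (∂ε_r⁻¹/∂x₃) |curl_α H|² + 2 Re((∇ε_r⁻¹·∂H/∂x₃) conj H₃)] dx
 + Re ∫_{Γ_h} (e₃×(R_α×H))·conj H ds − 2 Re ∫_{Γ_h} T_α(H₃) conj H₃ ds = 0`. -/
theorem rellich_identity
    (h : ℝ) (hh : 0 < h) (α : R3) (hα : α 2 = 0)
    (εinv : R3 → ℝ) (hε : EpsOK h εinv)
    (k : ℝ) (hk : 0 < k)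
    (H : R3 → C3) (hH : IsHomSol h k α εinv H) :
    (∫ x in Omg h,
      (2 * εinv x * nsq (pdV 2 H x)
        - x 2 * pdR 2 εinv x * nsq (curlA α H x)
        + 2 * ((((pdR 0 εinv x : ℂ) * pdV 2 H x 0 + (pdR 1 εinv x : ℂ) * pdV 2 H x 1
            + (pdR 2 εinv x : ℂ) * pdV 2 H x 2) * (starRingEnd ℂ) (H x 2)).re)))
    + (∫ p in sq2,
        ((pdA α 1 (fun y => H y 2) (bpt p h) - Talpha k α H h 1 p)
            * (starRingEnd ℂ) (H (bpt p h) 1)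
          - (Talpha k α H h 0 p - pdA α 0 (fun y => H y 2) (bpt p h))
            * (starRingEnd ℂ) (H (bpt p h) 0))).re
    - 2 * (∫ p in sq2, Talpha k α H h 2 p * (starRingEnd ℂ) (H (bpt p h) 2)).re = 0 := by
  have hT := hH.talpha_eq hε hα hk
  have hC0 := fun p => curlA_zero α H (bpt p h)
  have hC1 := fun p => curlA_one α H (bpt p h)
  simp only [pdA_two hα] at hC0 hC1
  have hW := contDiff_rellichFlux hε hH
  have key := setIntegral_Omg_div hh hW (biperiodic_rellichFlux hε hH)
  simp only [rellichFlux_two_bottom hH, integral_zero, sub_zero] at key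
  rw [hH.integral_rellichFlux_top hε hh hα hk] at key
  have hint : IntegrableOn (fun x => ∑ i, pdC i (rellichFlux k α εinv H i) x) (Omg h) :=
    integrableOn_Omg h (continuous_finsetSum _ fun i _ => continuous_pdC (hW i))
  have hre := integral_re hint
  simp only [RCLike.re_to_complex] at hre
  rw [key, setIntegral_congr_fun (measurableSet_Omg h)
    fun x hx => hH.re_sum_pdC_rellichFlux hε hα hx, integral_neg] at hre
  simp only [hT, hC0, hC1, Complex.sub_re, Complex.mul_re, Complex.conj_re, Complex.re_ofNat,
    Complex.im_ofNat, zero_mul, sub_zero] at hre ⊢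
  linarith
end
end

section
/- Unique continuation principle: let O be an open, connected and simply connected subset of ℝ², and let u₁, …, u_m : O → ℝ be twice continuously differentiable functions for which there exists a constant C such that |Δu_j| ≤ C Σ_{l=1}^{m} ( |u_l| + |∇u_l| ) in O for each j = 1, …, m. If every u_j vanishes on some common open and non-empty subset of O, then u₁, …, u_m vanish identically in O. -/
open MeasureTheory Real

noncomputable section

/-- Directional derivative of a function on `ℝ²`. -/
def pd2 (v : ℝ × ℝ) (f : ℝ × ℝ → ℝ) (x : ℝ × ℝ) : ℝ := fderiv ℝ f x v

/-- The Laplacian on `ℝ²`, via iterated directional derivatives. -/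
def lap2 (f : ℝ × ℝ → ℝ) (x : ℝ × ℝ) : ℝ :=
  pd2 (1, 0) (pd2 (1, 0) f) x + pd2 (0, 1) (pd2 (0, 1) f) x

/-- Euclidean norm of the gradient of a function on `ℝ²`. -/
def gradNorm2 (f : ℝ × ℝ → ℝ) (x : ℝ × ℝ) : ℝ :=
  Real.sqrt ((pd2 (1, 0) f x) ^ 2 + (pd2 (0, 1) f x) ^ 2)

section CauchyRiemann

open Filter Topology Set

theorem ContDiff.continuous_pd2 {f : ℝ × ℝ → ℝ} (hf : ContDiff ℝ 1 f) (v : ℝ × ℝ) :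
    Continuous (pd2 v f) :=
  (hf.continuous_fderiv one_ne_zero).clm_apply continuous_const

theorem ContDiff.contDiff_pd2 {f : ℝ × ℝ → ℝ} (hf : ContDiff ℝ 2 f) (v : ℝ × ℝ) :
    ContDiff ℝ 1 (pd2 v f) :=
  (hf.fderiv_right (m := 1) (by norm_num)).clm_apply contDiff_const

theorem pd2_eq_zero_of_notMem_tsupport {f : ℝ × ℝ → ℝ} {x : ℝ × ℝ} (hx : x ∉ tsupport f)
    (v : ℝ × ℝ) : pd2 v f x = 0 := by
  simp [pd2, fderiv_of_notMem_tsupport (𝕜 := ℝ) hx]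

theorem HasCompactSupport.pd2 {f : ℝ × ℝ → ℝ} (hf : HasCompactSupport f) (v : ℝ × ℝ) :
    HasCompactSupport (pd2 v f) :=
  .intro hf fun _ hx => pd2_eq_zero_of_notMem_tsupport hx v

theorem pd2_mul {f g : ℝ × ℝ → ℝ} {x : ℝ × ℝ} (hf : DifferentiableAt ℝ f x)
    (hg : DifferentiableAt ℝ g x) (v : ℝ × ℝ) :
    pd2 v (fun y => f y * g y) x = f x * pd2 v g x + pd2 v f x * g x := by
  simp only [pd2, fderiv_fun_mul hf hg]
  simp; ring

/-- Integration by parts against a compactly supported function on the plane. -/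
theorem integral_mul_pd2_eq_neg {f g : ℝ × ℝ → ℝ} (hf : ContDiff ℝ 1 f) (hg : ContDiff ℝ 1 g)
    (hgc : HasCompactSupport g) (v : ℝ × ℝ) :
    ∫ x, f x * pd2 v g x = -∫ x, pd2 v f x * g x := by
  refine integral_mul_fderiv_eq_neg_fderiv_mul_of_integrable ?_ ?_ ?_
    (fun x _ => (hf.differentiable one_ne_zero).differentiableAt)
    (fun x _ => (hg.differentiable one_ne_zero).differentiableAt)
  · exact ((hf.continuous_pd2 v).mul hg.continuous).integrable_of_hasCompactSupport hgc.mul_left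
  · exact (hf.continuous.mul (hg.continuous_pd2 v)).integrable_of_hasCompactSupport
      (hgc.pd2 v).mul_left
  · exact (hf.continuous.mul hg.continuous).integrable_of_hasCompactSupport hgc.mul_left

/-- The Jacobian determinant of a compactly supported `C¹` map of the plane has zero integral. -/
theorem integral_pd2_mul_pd2_comm {a b : ℝ × ℝ → ℝ} (ha : ContDiff ℝ 1 a) (hb : ContDiff ℝ 1 b)
    (hac : HasCompactSupport a) (hbc : HasCompactSupport b) (v w : ℝ × ℝ) :
    ∫ x, pd2 v a x * pd2 w b x = ∫ x, pd2 w a x * pd2 v b x := by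
  obtain ⟨Ka, hKa⟩ := ha.lipschitzWith_of_hasCompactSupport hac one_ne_zero
  obtain ⟨Kb, hKb⟩ := hb.lipschitzWith_of_hasCompactSupport hbc one_ne_zero
  have lineDeriv_eq : ∀ {f : ℝ × ℝ → ℝ}, ContDiff ℝ 1 f → ∀ x z, lineDeriv ℝ f x z = pd2 z f x :=
    fun hf x z => (hf.differentiable one_ne_zero).differentiableAt.lineDeriv_eq_fderiv
  have hib := (hb.continuous_pd2 w).integrable_of_hasCompactSupport (μ := volume) (hbc.pd2 w)
  have hia := (ha.continuous_pd2 w).integrable_of_hasCompactSupport (μ := volume) (hac.pd2 w)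
  have A := hKa.integral_inv_smul_sub_mul_tendsto_integral_lineDeriv_mul (μ := volume) hib v
  have B := hKb.integral_inv_smul_sub_mul_tendsto_integral_lineDeriv_mul (μ := volume) hia (-v)
  simp only [lineDeriv_eq ha, lineDeriv_eq hb] at A B
  have key : ∀ t : ℝ, ∫ x, (t⁻¹ • (a (x + t • v) - a x)) * pd2 w b x =
      -∫ x, (t⁻¹ • (b (x + t • (-v)) - b x)) * pd2 w a x := by
    intro t
    have hat : ContDiff ℝ 1 fun x => a (x + t • v) := ha.comp (contDiff_id.add contDiff_const)
    have hpd : ∀ x, pd2 w (fun x => t⁻¹ • (a (x + t • v) - a x)) x =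
        t⁻¹ * (pd2 w a (x + t • v) - pd2 w a x) := by
      intro x
      have h1 := (hat.differentiable one_ne_zero x)
      have h2 := (ha.differentiable one_ne_zero x)
      simp only [pd2]
      rw [fderiv_fun_const_smul (h1.fun_sub h2), fderiv_fun_sub h1 h2, fderiv_comp_add_right]
      simp
    have hsh : ∀ y : ℝ × ℝ, HasCompactSupport fun x => b (x + y) := fun y =>
      hbc.comp_homeomorph (Homeomorph.addRight y)
    have hbi : Integrable fun x => pd2 w a x * b x :=
      ((ha.continuous_pd2 w).mul hb.continuous).integrable_of_hasCompactSupport hbc.mul_left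
    have hbs : Integrable fun x => pd2 w a x * b (x + t • (-v)) :=
      ((ha.continuous_pd2 w).mul (hb.continuous.comp
        (continuous_id.add continuous_const))).integrable_of_hasCompactSupport (hsh _).mul_left
    have has : Integrable fun x => pd2 w a (x + t • v) * b x :=
      (((ha.continuous_pd2 w).comp (continuous_id.add continuous_const)).mul
        hb.continuous).integrable_of_hasCompactSupport hbc.mul_left
    have hshift : ∫ x, pd2 w a (x + t • v) * b x = ∫ x, pd2 w a x * b (x + t • (-v)) := by
      rw [← integral_add_right_eq_self (fun x => pd2 w a x * b (x + t • (-v))) (t • v)]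
      simp
    rw [integral_mul_pd2_eq_neg ((hat.sub ha).const_smul t⁻¹) hb hbc w]
    congr 1
    simp only [hpd]
    calc ∫ x, t⁻¹ * (pd2 w a (x + t • v) - pd2 w a x) * b x
        = ∫ x, t⁻¹ * (pd2 w a (x + t • v) * b x - pd2 w a x * b x) := by
          congr 1; ext x; ring
      _ = ∫ x, t⁻¹ * (pd2 w a x * b (x + t • (-v)) - pd2 w a x * b x) := by
          rw [integral_const_mul, integral_const_mul, integral_sub has hbi,
            integral_sub hbs hbi, hshift]
      _ = _ := by congr 1; ext x; simp only [smul_eq_mul]; ring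
  simp only [key] at A
  have := tendsto_nhds_unique A B.neg
  rw [this, ← integral_neg]
  congr 1; ext x
  simp only [pd2, map_neg]; ring

/-- The weighted `L²` inequality for the Cauchy-Riemann operator, in conjugated form. -/
theorem carleman_conjugated {φ a b : ℝ × ℝ → ℝ} (hφ : ContDiff ℝ 2 φ) (ha : ContDiff ℝ 1 a)
    (hb : ContDiff ℝ 1 b) (hac : HasCompactSupport a) (hbc : HasCompactSupport b) :
    2 * ∫ x, lap2 φ x * (a x ^ 2 + b x ^ 2) ≤
      ∫ x, ((pd2 (1, 0) a x - pd2 (0, 1) b x - pd2 (1, 0) φ x * a x + pd2 (0, 1) φ x * b x) ^ 2 +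
        (pd2 (1, 0) b x + pd2 (0, 1) a x - pd2 (1, 0) φ x * b x - pd2 (0, 1) φ x * a x) ^ 2) := by
  have hφ1 : ContDiff ℝ 1 φ := hφ.of_le one_le_two
  set h : ℝ × ℝ → ℝ := fun x => a x ^ 2 + b x ^ 2 with hh
  have hhC : ContDiff ℝ 1 h := (ha.pow 2).add (hb.pow 2)
  have notMem_a : ∀ {x}, x ∉ tsupport a ∪ tsupport b → x ∉ tsupport a :=
    fun hx h => hx (Or.inl h)
  have notMem_b : ∀ {x}, x ∉ tsupport a ∪ tsupport b → x ∉ tsupport b :=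
    fun hx h => hx (Or.inr h)
  have a0 : ∀ x, x ∉ tsupport a ∪ tsupport b → a x = 0 :=
    fun x hx => image_eq_zero_of_notMem_tsupport (notMem_a hx)
  have b0 : ∀ x, x ∉ tsupport a ∪ tsupport b → b x = 0 :=
    fun x hx => image_eq_zero_of_notMem_tsupport (notMem_b hx)
  have pa0 : ∀ x, x ∉ tsupport a ∪ tsupport b → ∀ v, pd2 v a x = 0 :=
    fun x hx => pd2_eq_zero_of_notMem_tsupport (notMem_a hx)
  have pb0 : ∀ x, x ∉ tsupport a ∪ tsupport b → ∀ v, pd2 v b x = 0 :=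
    fun x hx => pd2_eq_zero_of_notMem_tsupport (notMem_b hx)
  have hK : IsCompact (tsupport a ∪ tsupport b) := hac.isCompact.union hbc.isCompact
  have hhc : HasCompactSupport h := .intro hK fun x hx => by simp [hh, a0 x hx, b0 x hx]
  have integ : ∀ {F : ℝ × ℝ → ℝ}, Continuous F →
      (∀ x, x ∉ tsupport a ∪ tsupport b → F x = 0) → Integrable F :=
    fun hF h0 => hF.integrable_of_hasCompactSupport (.intro hK h0)
  have pdh : ∀ v x, pd2 v h x = 2 * (a x * pd2 v a x + b x * pd2 v b x) := by
    intro v x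
    have h1 := ha.differentiable one_ne_zero x
    have h2 := hb.differentiable one_ne_zero x
    have : h = fun y => a y * a y + b y * b y := by ext y; simp only [hh]; ring
    rw [this]
    simp only [pd2]
    rw [fderiv_fun_add (h1.fun_mul h1) (h2.fun_mul h2), fderiv_fun_mul h1 h1, fderiv_fun_mul h2 h2]
    simp; ring
  have ca := ha.continuous
  have cb := hb.continuous
  have cax := ha.continuous_pd2 (1, 0)
  have cay := ha.continuous_pd2 (0, 1)
  have cbx := hb.continuous_pd2 (1, 0)
  have cby := hb.continuous_pd2 (0, 1)
  have cφx := hφ1.continuous_pd2 (1, 0)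
  have cφy := hφ1.continuous_pd2 (0, 1)
  have cφxx := (hφ.contDiff_pd2 (1, 0)).continuous_pd2 (1, 0)
  have cφyy := (hφ.contDiff_pd2 (0, 1)).continuous_pd2 (0, 1)
  have chx := hhC.continuous_pd2 (1, 0)
  have chy := hhC.continuous_pd2 (0, 1)
  have phx0 : ∀ x, x ∉ tsupport a ∪ tsupport b → ∀ v, pd2 v h x = 0 := fun x hx v => by
    simp [pdh, a0 x hx, b0 x hx]
  have I1 : Integrable fun x => pd2 (0, 1) a x * pd2 (1, 0) b x :=
    integ (by fun_prop) fun x hx => by simp [pa0 x hx]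
  have I2 : Integrable fun x => pd2 (1, 0) a x * pd2 (0, 1) b x :=
    integ (by fun_prop) fun x hx => by simp [pa0 x hx]
  have I3 : Integrable fun x => pd2 (1, 0) φ x * pd2 (1, 0) h x :=
    integ (by fun_prop) fun x hx => by simp [phx0 x hx]
  have I4 : Integrable fun x => pd2 (0, 1) φ x * pd2 (0, 1) h x :=
    integ (by fun_prop) fun x hx => by simp [phx0 x hx]
  have I5 : Integrable fun x => pd2 (1, 0) (pd2 (1, 0) φ) x * h x :=
    integ (by fun_prop) fun x hx => by simp [hh, a0 x hx, b0 x hx]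
  have I6 : Integrable fun x => pd2 (0, 1) (pd2 (0, 1) φ) x * h x :=
    integ (by fun_prop) fun x hx => by simp [hh, a0 x hx, b0 x hx]
  have I12 : Integrable fun x => 4 * (pd2 (0, 1) a x * pd2 (1, 0) b x -
      pd2 (1, 0) a x * pd2 (0, 1) b x) := (I1.sub I2).const_mul 4
  have I34 : Integrable fun x => 2 * (pd2 (1, 0) φ x * pd2 (1, 0) h x +
      pd2 (0, 1) φ x * pd2 (0, 1) h x) := (I3.add I4).const_mul 2
  have ibpx := integral_mul_pd2_eq_neg (hφ.contDiff_pd2 (1, 0)) hhC hhc (1, 0)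
  have ibpy := integral_mul_pd2_eq_neg (hφ.contDiff_pd2 (0, 1)) hhC hhc (0, 1)
  have jac := integral_pd2_mul_pd2_comm ha hb hac hbc (0, 1) (1, 0)
  have lhs : 2 * ∫ x, lap2 φ x * h x = ∫ x, (4 * (pd2 (0, 1) a x * pd2 (1, 0) b x -
      pd2 (1, 0) a x * pd2 (0, 1) b x) - 2 * (pd2 (1, 0) φ x * pd2 (1, 0) h x +
        pd2 (0, 1) φ x * pd2 (0, 1) h x)) := by
    rw [integral_sub I12 I34, integral_const_mul,
      integral_const_mul, integral_sub I1 I2, integral_add I3 I4, ibpx, ibpy, jac]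
    simp only [lap2, add_mul]
    rw [integral_add I5 I6]
    ring
  rw [lhs]
  refine integral_mono (I12.sub I34)
    (integ (by fun_prop) fun x hx => by simp [a0 x hx, b0 x hx, pa0 x hx, pb0 x hx]) fun x => ?_
  simp only [pdh]
  nlinarith [sq_nonneg (pd2 (1, 0) a x + pd2 (0, 1) b x + pd2 (1, 0) φ x * a x +
      pd2 (0, 1) φ x * b x),
    sq_nonneg (pd2 (1, 0) b x - pd2 (0, 1) a x + pd2 (1, 0) φ x * b x - pd2 (0, 1) φ x * a x)]

/-- The weighted `L²` inequality for the Cauchy-Riemann operator. -/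
theorem carleman {φ f g : ℝ × ℝ → ℝ} (hφ : ContDiff ℝ 2 φ) (hf : ContDiff ℝ 1 f)
    (hg : ContDiff ℝ 1 g) (hfc : HasCompactSupport f) (hgc : HasCompactSupport g) :
    2 * ∫ x, lap2 φ x * (rexp (φ x) ^ 2 * (f x ^ 2 + g x ^ 2)) ≤
      ∫ x, rexp (φ x) ^ 2 * ((pd2 (1, 0) f x - pd2 (0, 1) g x) ^ 2 +
        (pd2 (1, 0) g x + pd2 (0, 1) f x) ^ 2) := by
  have hφ1 : ContDiff ℝ 1 φ := hφ.of_le one_le_two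
  have hpd : ∀ {k : ℝ × ℝ → ℝ}, ContDiff ℝ 1 k → ∀ v x, pd2 v (fun y => rexp (φ y) * k y) x =
      rexp (φ x) * (pd2 v k x + pd2 v φ x * k x) := by
    intro k hk v x
    have hφd := hφ1.differentiable one_ne_zero x
    rw [pd2_mul hφd.exp (hk.differentiable one_ne_zero x)]
    simp only [pd2, fderiv_exp hφd]
    simp; ring
  have key := carleman_conjugated hφ (hφ1.exp.mul hf) (hφ1.exp.mul hg) hfc.mul_left hgc.mul_left
  simp only [hpd hf, hpd hg] at key
  convert key using 3 with x
  · ext x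
    ring
  · ring

/-- The square of the Euclidean distance between two points of the plane. -/
def sqDist (p x : ℝ × ℝ) : ℝ := (x.1 - p.1) ^ 2 + (x.2 - p.2) ^ 2

theorem contDiff_sqDist (p : ℝ × ℝ) {n : WithTop ℕ∞} : ContDiff ℝ n (sqDist p) :=
  ((contDiff_fst.sub contDiff_const).pow 2).add ((contDiff_snd.sub contDiff_const).pow 2)

theorem sqDist_nonneg (p x : ℝ × ℝ) : 0 ≤ sqDist p x := by
  unfold sqDist; positivity

theorem dist_lt_of_sqDist_lt {p x : ℝ × ℝ} {r : ℝ} (hr : 0 < r) (h : sqDist p x < r ^ 2) :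
    dist x p < r := by
  rw [Prod.dist_eq, max_lt_iff, Real.dist_eq, Real.dist_eq]
  unfold sqDist at h
  exact ⟨abs_lt_of_sq_lt_sq (by nlinarith [sq_nonneg (x.2 - p.2)]) hr.le,
    abs_lt_of_sq_lt_sq (by nlinarith [sq_nonneg (x.1 - p.1)]) hr.le⟩

theorem sqDist_lt_of_dist_lt {p x : ℝ × ℝ} {r : ℝ} (h : dist x p < r) :
    sqDist p x < 2 * r ^ 2 := by
  rw [Prod.dist_eq, max_lt_iff, Real.dist_eq, Real.dist_eq] at h
  have h1 := sq_lt_sq' (abs_lt.1 h.1).1 (abs_lt.1 h.1).2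
  have h2 := sq_lt_sq' (abs_lt.1 h.2).1 (abs_lt.1 h.2).2
  unfold sqDist
  linarith

theorem isCompact_sqDist_le (p : ℝ × ℝ) (r : ℝ) : IsCompact {x | sqDist p x ≤ r} := by
  refine (isCompact_closedBall p (√(r + 1))).of_isClosed_subset
    (isClosed_le (contDiff_sqDist p (n := 0)).continuous continuous_const) fun x hx => ?_
  rcases lt_or_ge r 0 with hr | hr
  · exact absurd (hx.trans_lt hr) (sqDist_nonneg p x).not_gt
  · refine (dist_lt_of_sqDist_lt (by positivity) ?_).le
    rw [Real.sq_sqrt (by positivity)]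
    exact lt_of_le_of_lt hx (lt_add_one r)

/-- A smooth weight, radially decreasing about `p` and vanishing at squared distance `R`. -/
def radialWeight (p : ℝ × ℝ) (k R τ : ℝ) (x : ℝ × ℝ) : ℝ :=
  τ * (rexp (-k * sqDist p x) - rexp (-k * R))

theorem contDiff_radialWeight (p : ℝ × ℝ) (k R τ : ℝ) {n : WithTop ℕ∞} :
    ContDiff ℝ n (radialWeight p k R τ) :=
  contDiff_const.mul ((contDiff_const.mul (contDiff_sqDist p)).exp.sub contDiff_const)

theorem pd2_eq_of_hasDerivAt {f : ℝ × ℝ → ℝ} {x v : ℝ × ℝ} {d : ℝ}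
    (hf : DifferentiableAt ℝ f x) (h : HasDerivAt (fun t : ℝ => f (x + t • v)) d 0) :
    pd2 v f x = d :=
  (HasDerivAt.unique h (hf.hasFDerivAt.hasLineDerivAt v)).symm

theorem lap2_radialWeight (p : ℝ × ℝ) (k R τ : ℝ) (x : ℝ × ℝ) :
    lap2 (radialWeight p k R τ) x =
      τ * (4 * k * (k * sqDist p x - 1) * rexp (-k * sqDist p x)) := by
  have hq : ContDiff ℝ 1 fun y => rexp (-k * sqDist p y) :=
    (contDiff_const.mul (contDiff_sqDist p)).exp
  have d1 : ∀ y : ℝ × ℝ, HasDerivAt (fun t : ℝ => sqDist p (y + t • (1, 0)))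
      (2 * (y.1 - p.1)) 0 := by
    intro y
    have e : (fun t : ℝ => sqDist p (y + t • (1, 0))) = fun t => (y.1 + t - p.1) ^ 2 + (y.2 - p.2) ^ 2 := by
      ext t; simp [sqDist]
    rw [e]
    exact (((((hasDerivAt_id' (0 : ℝ)).const_add y.1).sub_const p.1).fun_pow 2).add_const
      ((y.2 - p.2) ^ 2)).congr_deriv (by simp)
  have d2 : ∀ y : ℝ × ℝ, HasDerivAt (fun t : ℝ => sqDist p (y + t • (0, 1)))
      (2 * (y.2 - p.2)) 0 := by
    intro y
    have e : (fun t : ℝ => sqDist p (y + t • (0, 1))) = fun t => (y.1 - p.1) ^ 2 + (y.2 + t - p.2) ^ 2 := by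
      ext t; simp [sqDist]
    rw [e]
    exact (((((hasDerivAt_id' (0 : ℝ)).const_add y.2).sub_const p.2).fun_pow 2).const_add
      ((y.1 - p.1) ^ 2)).congr_deriv (by simp)
  have e1 : pd2 (1, 0) (radialWeight p k R τ) =
      fun y => τ * (-2 * k * (y.1 - p.1) * rexp (-k * sqDist p y)) := by
    ext y
    refine pd2_eq_of_hasDerivAt
      ((contDiff_radialWeight p k R τ (n := 1)).differentiable one_ne_zero y) ?_
    refine ((((d1 y).const_mul (-k)).exp.sub_const (rexp (-k * R))).const_mul τ).congr_deriv ?_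
    simp only [zero_smul, add_zero]; ring
  have e2 : pd2 (0, 1) (radialWeight p k R τ) =
      fun y => τ * (-2 * k * (y.2 - p.2) * rexp (-k * sqDist p y)) := by
    ext y
    refine pd2_eq_of_hasDerivAt
      ((contDiff_radialWeight p k R τ (n := 1)).differentiable one_ne_zero y) ?_
    refine ((((d2 y).const_mul (-k)).exp.sub_const (rexp (-k * R))).const_mul τ).congr_deriv ?_
    simp only [zero_smul, add_zero]; ring
  have e11 : pd2 (1, 0) (pd2 (1, 0) (radialWeight p k R τ)) x =
      τ * ((4 * k ^ 2 * (x.1 - p.1) ^ 2 - 2 * k) * rexp (-k * sqDist p x)) := by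
    rw [e1]
    refine pd2_eq_of_hasDerivAt ?_ ?_
    · exact (contDiff_const.mul ((contDiff_const.mul (contDiff_fst.sub contDiff_const)).mul
        hq)).differentiable one_ne_zero x
    have l : HasDerivAt (fun t : ℝ => (x + t • ((1, 0) : ℝ × ℝ)).1 - p.1) 1 0 := by
      simpa using ((hasDerivAt_id (0 : ℝ)).const_add x.1).sub_const p.1
    refine ((l.const_mul (-2 * k)).mul ((d1 x).const_mul (-k)).exp).const_mul τ |>.congr_deriv ?_
    simp only [zero_smul, add_zero]; ring
  have e22 : pd2 (0, 1) (pd2 (0, 1) (radialWeight p k R τ)) x =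
      τ * ((4 * k ^ 2 * (x.2 - p.2) ^ 2 - 2 * k) * rexp (-k * sqDist p x)) := by
    rw [e2]
    refine pd2_eq_of_hasDerivAt ?_ ?_
    · exact (contDiff_const.mul ((contDiff_const.mul (contDiff_snd.sub contDiff_const)).mul
        hq)).differentiable one_ne_zero x
    have l : HasDerivAt (fun t : ℝ => (x + t • ((0, 1) : ℝ × ℝ)).2 - p.2) 1 0 := by
      simpa using ((hasDerivAt_id (0 : ℝ)).const_add x.2).sub_const p.2
    refine ((l.const_mul (-2 * k)).mul ((d2 x).const_mul (-k)).exp).const_mul τ |>.congr_deriv ?_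
    simp only [zero_smul, add_zero]; ring
  rw [lap2, e11, e22, sqDist]
  ring

/-- Unique continuation across circles for the differential inequality `|∂̄F| ≤ C|F|`, where
`F` is a family of compactly supported `C¹` functions `f i + √-1 * g i`. -/
theorem eq_zero_of_cauchyRiemann_le {ι : Type*} [Fintype ι] {f g : ι → ℝ × ℝ → ℝ}
    (hf : ∀ i, ContDiff ℝ 1 (f i)) (hg : ∀ i, ContDiff ℝ 1 (g i))
    (hfc : ∀ i, HasCompactSupport (f i)) (hgc : ∀ i, HasCompactSupport (g i))
    {p : ℝ × ℝ} {r R K : ℝ} (hr : 0 < r)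
    (hzero : ∀ i x, sqDist p x < r → f i x = 0 ∧ g i x = 0)
    (hle : ∀ x, sqDist p x < R →
      ∑ i, ((pd2 (1, 0) (f i) x - pd2 (0, 1) (g i) x) ^ 2 +
        (pd2 (1, 0) (g i) x + pd2 (0, 1) (f i) x) ^ 2) ≤ K * ∑ i, (f i x ^ 2 + g i x ^ 2))
    (i : ι) {x : ℝ × ℝ} (hx : sqDist p x < R) : f i x = 0 ∧ g i x = 0 := by
  set F : ℝ × ℝ → ℝ := fun x => ∑ i, (f i x ^ 2 + g i x ^ 2) with hF
  set D : ι → ℝ × ℝ → ℝ := fun i x => (pd2 (1, 0) (f i) x - pd2 (0, 1) (g i) x) ^ 2 +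
        (pd2 (1, 0) (g i) x + pd2 (0, 1) (f i) x) ^ 2 with hD
  set T : ℝ × ℝ → ℝ := fun x => ∑ i, D i x with hT
  set S : Set (ℝ × ℝ) := {x | sqDist p x < R} with hS
  have hSo : IsOpen S := isOpen_lt (contDiff_sqDist p (n := 0)).continuous continuous_const
  have cf := fun i => (hf i).continuous
  have cg := fun i => (hg i).continuous
  have cD : ∀ i, Continuous (D i) := fun i => by
    have h1 := (hf i).continuous_pd2 (1, 0)
    have h2 := (hf i).continuous_pd2 (0, 1)
    have h3 := (hg i).continuous_pd2 (1, 0)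
    have h4 := (hg i).continuous_pd2 (0, 1)
    fun_prop
  have sF : ∀ i, HasCompactSupport fun x => f i x ^ 2 + g i x ^ 2 := fun i => by
    refine .intro ((hfc i).isCompact.union (hgc i).isCompact) fun x hx => ?_
    simp [image_eq_zero_of_notMem_tsupport fun h => hx (Or.inl h),
      image_eq_zero_of_notMem_tsupport fun h => hx (Or.inr h)]
  have sD : ∀ i, HasCompactSupport (D i) := fun i => by
    refine .intro ((hfc i).isCompact.union (hgc i).isCompact) fun x hx => ?_
    simp [hD, pd2_eq_zero_of_notMem_tsupport fun h => hx (Or.inl h),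
      pd2_eq_zero_of_notMem_tsupport fun h => hx (Or.inr h)]
  have integ : ∀ {W h : ℝ × ℝ → ℝ}, Continuous W → Continuous h → HasCompactSupport h →
      Integrable fun x => W x * h x := fun hW hh hc =>
    (hW.mul hh).integrable_of_hasCompactSupport hc.mul_left
  have integF : ∀ {W : ℝ × ℝ → ℝ}, Continuous W → Integrable fun x => W x * F x := by
    intro W hW
    simp only [hF, Finset.mul_sum]
    exact integrable_finsetSum _ fun i _ => integ hW (by fun_prop) (sF i)
  have integT : ∀ {W : ℝ × ℝ → ℝ}, Continuous W → Integrable fun x => W x * T x := by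
    intro W hW
    simp only [hT, Finset.mul_sum]
    exact integrable_finsetSum _ fun i _ => integ hW (cD i) (sD i)
  have cF : Continuous F := by fun_prop
  have iF : Integrable F := by simpa using integF (W := fun _ => 1) continuous_const
  have iT : Integrable T := by simpa using integT (W := fun _ => 1) continuous_const
  have F_nonneg : ∀ x, 0 ≤ F x := fun x => Finset.sum_nonneg fun i _ => by positivity
  have T_nonneg : ∀ x, 0 ≤ T x := fun x => Finset.sum_nonneg fun i _ => by positivity
  have F_zero : ∀ x, sqDist p x < r → F x = 0 := fun x hx =>
    Finset.sum_eq_zero fun i _ => by simp [hzero i x hx]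
  set k : ℝ := 2 / r with hk
  have hkpos : 0 < k := by positivity
  set c : ℝ := 4 * k * rexp (-k * R) with hc
  have hcpos : 0 < c := by positivity
  have estimate : ∀ τ : ℝ, 0 ≤ τ → ∃ I : ℝ, ∫ x in S, F x ≤ I ∧
      2 * (τ * c * I) ≤ K * I + ∫ x, T x := by
    intro τ hτ
    set φ := radialWeight p k R τ with hφ
    have hφC : ContDiff ℝ 2 φ := contDiff_radialWeight p k R τ
    set W : ℝ × ℝ → ℝ := fun x => rexp (φ x) ^ 2 with hW
    have cW : Continuous W := by
      have := hφC.continuous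
      fun_prop
    have cL : Continuous fun x => lap2 φ x * W x :=
      (((hφC.contDiff_pd2 (1, 0)).continuous_pd2 (1, 0)).add
        ((hφC.contDiff_pd2 (0, 1)).continuous_pd2 (0, 1))).mul cW
    have W_in : ∀ x ∈ S, 1 ≤ W x := fun x hx => by
      refine one_le_pow₀ (Real.one_le_exp (mul_nonneg hτ (sub_nonneg.2 (Real.exp_le_exp.2 ?_))))
      have : sqDist p x < R := hx
      nlinarith
    have W_out : ∀ x ∉ S, W x ≤ 1 := fun x hx => by
      refine pow_le_one₀ (by positivity) (Real.exp_le_one_iff.2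
        (mul_nonpos_of_nonneg_of_nonpos hτ (sub_nonpos.2 (Real.exp_le_exp.2 ?_))))
      have : R ≤ sqDist p x := not_lt.1 hx
      nlinarith
    have W_pos : ∀ x, 0 < W x := fun x => by positivity
    have iS : Integrable (S.indicator fun x => W x * F x) :=
      (integF cW).indicator hSo.measurableSet
    refine ⟨∫ x in S, W x * F x, ?_, ?_⟩
    · refine setIntegral_mono_on iF.integrableOn (integF cW).integrableOn hSo.measurableSet
        fun x hx => le_mul_of_one_le_left (F_nonneg x) (W_in x hx)
    have carl : 2 * ∫ x, lap2 φ x * W x * F x ≤ ∫ x, W x * T x := by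
      simp only [hF, hT, Finset.mul_sum]
      rw [integral_finsetSum _ fun i _ => integ cL (by fun_prop) (sF i),
        integral_finsetSum _ fun i _ => integ cW (cD i) (sD i), Finset.mul_sum]
      refine Finset.sum_le_sum fun i _ => ?_
      simpa only [mul_assoc] using carleman hφC (hf i) (hg i) (hfc i) (hgc i)
    have low : τ * c * ∫ x in S, W x * F x ≤ ∫ x, lap2 φ x * W x * F x := by
      rw [← integral_indicator hSo.measurableSet, ← integral_const_mul]
      refine integral_mono (iS.const_mul _) (integF cL) fun x => ?_
      rcases lt_or_ge (sqDist p x) r with hxr | hxr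
      · simp [indicator, F_zero x hxr]
      have h1 : 1 ≤ k * sqDist p x - 1 := by
        have : k * r = 2 := by rw [hk]; field_simp
        nlinarith
      have hWF : 0 ≤ W x * F x := mul_nonneg (W_pos x).le (F_nonneg x)
      simp only [hφ, lap2_radialWeight]
      rw [mul_assoc _ (W x) (F x)]
      by_cases hxS : x ∈ S
      · rw [indicator_of_mem hxS]
        refine mul_le_mul_of_nonneg_right (mul_le_mul_of_nonneg_left ?_ hτ) hWF
        have h2 : rexp (-k * R) ≤ rexp (-k * sqDist p x) := by
          have : sqDist p x < R := hxS
          exact Real.exp_le_exp.2 (by nlinarith)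
        calc c ≤ 4 * k * 1 * rexp (-k * sqDist p x) := by rw [hc, mul_one]; gcongr
          _ ≤ _ := by gcongr
      · rw [indicator_of_notMem hxS, mul_zero]
        have : 0 ≤ k * sqDist p x - 1 := by linarith
        positivity
    have up : ∫ x, W x * T x ≤ K * (∫ x in S, W x * F x) + ∫ x, T x := by
      rw [← integral_indicator hSo.measurableSet, ← integral_const_mul,
        ← integral_add (iS.const_mul _) iT]
      refine integral_mono (integT cW) ((iS.const_mul _).add iT) fun x => ?_
      by_cases hxS : x ∈ S
      · simp only [indicator_of_mem hxS]
        nlinarith [mul_le_mul_of_nonneg_left (hle x hxS) (W_pos x).le, T_nonneg x]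
      · simp only [indicator_of_notMem hxS]
        nlinarith [W_out x hxS, T_nonneg x]
    linarith
  have J_nonpos : ∫ x in S, F x ≤ 0 := by
    by_contra! hJ
    set J := ∫ x in S, F x
    set N := ∫ x, T x
    have hN : 0 ≤ N := integral_nonneg T_nonneg
    obtain ⟨I, hJI, hI⟩ := estimate ((|K| + N / J + 1) / (2 * c)) (by positivity)
    have e1 : 2 * ((|K| + N / J + 1) / (2 * c) * c * I) = (|K| + N / J + 1) * I := by
      field_simp
    have e2 : N / J * J = N := by field_simp
    have h1 : N / J * J ≤ N / J * I := mul_le_mul_of_nonneg_left hJI (by positivity)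
    have h2 : K * I ≤ |K| * I := mul_le_mul_of_nonneg_right (le_abs_self K) (by linarith)
    rw [e1] at hI
    nlinarith
  have F_eq : F x = 0 := by
    by_contra hne
    refine J_nonpos.not_gt ((setIntegral_pos_iff_support_of_nonneg_ae
      (ae_of_all _ F_nonneg) iF.integrableOn).2 ?_)
    exact (cF.isOpen_support.inter hSo).measure_pos _ ⟨x, hne, hx⟩
  have := (Finset.sum_eq_zero_iff_of_nonneg fun i _ => by positivity).1 F_eq i (Finset.mem_univ i)
  constructor <;> nlinarith [sq_nonneg (f i x), sq_nonneg (g i x)]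

theorem pd2_congr_of_eventuallyEq {f g : ℝ × ℝ → ℝ} {x : ℝ × ℝ} (h : f =ᶠ[𝓝 x] g)
    (v : ℝ × ℝ) : pd2 v f x = pd2 v g x := by
  rw [pd2, pd2, h.fderiv_eq]

theorem ContDiffOn.contDiffOn_pd2 {f : ℝ × ℝ → ℝ} {O : Set (ℝ × ℝ)} (hf : ContDiffOn ℝ 2 f O)
    (hO : IsOpen O) (v : ℝ × ℝ) : ContDiffOn ℝ 1 (pd2 v f) O :=
  (hf.fderiv_of_isOpen hO (m := 1) (by norm_num)).clm_apply contDiffOn_const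

theorem pd2_neg (f : ℝ × ℝ → ℝ) (v x : ℝ × ℝ) : pd2 v (fun y => -f y) x = -pd2 v f x := by
  simp [pd2, fderiv_fun_neg]

theorem pd2_comm {f : ℝ × ℝ → ℝ} {x : ℝ × ℝ} (hf : ContDiffAt ℝ 2 f x) (v w : ℝ × ℝ) :
    pd2 v (pd2 w f) x = pd2 w (pd2 v f) x := by
  have hd : DifferentiableAt ℝ (fderiv ℝ f) x :=
    (hf.fderiv_right (m := 1) (by norm_num)).differentiableAt one_ne_zero
  have h : ∀ v w : ℝ × ℝ, pd2 v (pd2 w f) x = fderiv ℝ (fderiv ℝ f) x v w := fun v w => by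
    change fderiv ℝ (fun y => fderiv ℝ f y w) x v = _
    rw [fderiv_clm_apply hd (differentiableAt_const w)]
    simp
  rw [h, h]
  exact hf.isSymmSndFDerivAt (by simp) v w

/-- Under the growth condition, the first-order system solved by `(u l, ∂u l)` satisfies a
differential inequality of Cauchy-Riemann type. -/
theorem sum_gradient_add_laplacian_le {m : ℕ} {u : Fin m → ℝ × ℝ → ℝ} {C : ℝ} {x : ℝ × ℝ}
    (h : ∀ j, |lap2 (u j) x| ≤ C * ∑ l, (|u l x| + gradNorm2 (u l) x)) :
    ∑ j, (pd2 (1, 0) (u j) x ^ 2 + pd2 (0, 1) (u j) x ^ 2) + ∑ j, lap2 (u j) x ^ 2 ≤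
      (1 + 2 * m ^ 2 * C ^ 2) * (∑ j, u j x ^ 2 +
        ∑ j, (pd2 (1, 0) (u j) x ^ 2 + pd2 (0, 1) (u j) x ^ 2)) := by
  set A := ∑ j, u j x ^ 2
  set B := ∑ j, (pd2 (1, 0) (u j) x ^ 2 + pd2 (0, 1) (u j) x ^ 2)
  have hA : 0 ≤ A := Finset.sum_nonneg fun _ _ => by positivity
  have hsum : (∑ l, (|u l x| + gradNorm2 (u l) x)) ^ 2 ≤ m * (2 * (A + B)) := by
    refine (sq_sum_le_card_mul_sum_sq (s := Finset.univ)).trans ?_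
    simp only [Finset.card_univ, Fintype.card_fin]
    refine mul_le_mul_of_nonneg_left ?_ (Nat.cast_nonneg m)
    rw [← Finset.sum_add_distrib, Finset.mul_sum]
    refine Finset.sum_le_sum fun l _ => ?_
    have hg : gradNorm2 (u l) x ^ 2 = pd2 (1, 0) (u l) x ^ 2 + pd2 (0, 1) (u l) x ^ 2 :=
      Real.sq_sqrt (by positivity)
    rw [← hg]
    nlinarith [sq_abs (u l x), sq_nonneg (|u l x| - gradNorm2 (u l) x)]
  have hlap : ∑ j, lap2 (u j) x ^ 2 ≤ m * (C ^ 2 * (m * (2 * (A + B)))) := by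
    calc ∑ j, lap2 (u j) x ^ 2 ≤ ∑ _j : Fin m, C ^ 2 * (m * (2 * (A + B))) := by
          refine Finset.sum_le_sum fun j _ => ?_
          calc lap2 (u j) x ^ 2 ≤ (C * ∑ l, (|u l x| + gradNorm2 (u l) x)) ^ 2 :=
                sq_le_sq' (by linarith [neg_abs_le (lap2 (u j) x), h j])
                  ((le_abs_self _).trans (h j))
            _ = C ^ 2 * (∑ l, (|u l x| + gradNorm2 (u l) x)) ^ 2 := mul_pow _ _ _
            _ ≤ _ := by gcongr
      _ = _ := by simp
  nlinarith

/-- The differential inequality propagates zeros from a disc to any concentric disc inside the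
domain. -/
theorem eq_zero_of_eq_zero_on_smaller_disc {O : Set (ℝ × ℝ)} (hO : IsOpen O) {m : ℕ}
    {u : Fin m → ℝ × ℝ → ℝ} (hu : ∀ j, ContDiffOn ℝ 2 (u j) O) {C : ℝ}
    (hgrowth : ∀ j, ∀ x ∈ O, |lap2 (u j) x| ≤ C * ∑ l, (|u l x| + gradNorm2 (u l) x))
    {p : ℝ × ℝ} {r R : ℝ} (hr : 0 < r) (hzero : ∀ j x, sqDist p x < r → u j x = 0)
    (hR : ∀ x, sqDist p x < R → x ∈ O) (j : Fin m) {x : ℝ × ℝ} (hx : sqDist p x < R) :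
    u j x = 0 := by
  obtain ⟨R₀, hxR₀, hR₀⟩ := exists_between hx
  obtain ⟨R₁, hR₀₁, hR₁⟩ := exists_between hR₀
  have cρ : Continuous (sqDist p) := (contDiff_sqDist p (n := 0)).continuous
  set ζ : ℝ × ℝ → ℝ := fun y => smoothTransition ((R₁ - sqDist p y) / (R₁ - R₀)) with hζ
  have hζC : ContDiff ℝ 1 ζ :=
    smoothTransition.contDiff.comp ((contDiff_const.sub (contDiff_sqDist p)).div_const _)
  have hgap : 0 < R₁ - R₀ := sub_pos.2 hR₀₁
  have ζ_one : ∀ y, sqDist p y < R₀ → ζ y = 1 := fun y hy =>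
    smoothTransition.one_of_one_le ((one_le_div hgap).2 (by linarith))
  have ζ_zero : ∀ y, R₁ ≤ sqDist p y → ζ y = 0 := fun y hy =>
    smoothTransition.zero_of_nonpos (div_nonpos_of_nonpos_of_nonneg (by linarith) hgap.le)
  have cut_contDiff : ∀ {G : ℝ × ℝ → ℝ}, ContDiffOn ℝ 1 G O →
      ContDiff ℝ 1 fun y => ζ y * G y := by
    intro G hG
    refine contDiff_iff_contDiffAt.2 fun y => ?_
    by_cases hy : y ∈ O
    · exact hζC.contDiffAt.mul (hG.contDiffAt (hO.mem_nhds hy))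
    · have hy' : R₁ < sqDist p y := lt_of_lt_of_le hR₁ (not_lt.1 fun h => hy (hR y h))
      refine (contDiffAt_const (c := (0 : ℝ))).congr_of_eventuallyEq ?_
      filter_upwards [(isOpen_lt continuous_const cρ).mem_nhds hy'] with z hz
      rw [ζ_zero z (le_of_lt hz), zero_mul]
  have cut_compact : ∀ G : ℝ × ℝ → ℝ, HasCompactSupport fun y => ζ y * G y := fun G =>
    .intro (isCompact_sqDist_le p R₁) fun y hy => by
      rw [ζ_zero y (not_le.1 hy).le, zero_mul]
  have cut_pd2 : ∀ (G : ℝ × ℝ → ℝ) {y}, sqDist p y < R₀ → ∀ v,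
      pd2 v (fun y => ζ y * G y) y = pd2 v G y := fun G y hy v => by
    refine pd2_congr_of_eventuallyEq ?_ v
    filter_upwards [(isOpen_lt cρ continuous_const).mem_nhds hy] with z hz
    rw [ζ_one z hz, one_mul]
  have grad_zero : ∀ l y, sqDist p y < r → ∀ v, pd2 v (u l) y = 0 := fun l y hy v => by
    have : u l =ᶠ[𝓝 y] fun _ => 0 := by
      filter_upwards [(isOpen_lt cρ continuous_const).mem_nhds hy] with z hz using hzero l z hz
    rw [pd2_congr_of_eventuallyEq this, pd2]
    simp
  have hu1 : ∀ l, ContDiffOn ℝ 1 (u l) O := fun l => (hu l).of_le one_le_two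
  have hx1 : ∀ l, ContDiffOn ℝ 1 (pd2 (1, 0) (u l)) O := fun l => (hu l).contDiffOn_pd2 hO _
  have hx2 : ∀ l, ContDiffOn ℝ 1 (fun y => -pd2 (0, 1) (u l) y) O := fun l =>
    ((hu l).contDiffOn_pd2 hO _).neg
  let f : Fin m ⊕ Fin m → ℝ × ℝ → ℝ := Sum.elim (fun l y => ζ y * u l y)
    fun l y => ζ y * pd2 (1, 0) (u l) y
  let g : Fin m ⊕ Fin m → ℝ × ℝ → ℝ := Sum.elim (fun _ y => ζ y * 0)
    fun l y => ζ y * -pd2 (0, 1) (u l) y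
  have main : f (.inl j) x = 0 ∧ g (.inl j) x = 0 := by
    refine eq_zero_of_cauchyRiemann_le (f := f) (g := g) (p := p) (r := r) (R := R₀)
      (K := 1 + 2 * m ^ 2 * C ^ 2) ?_ ?_ ?_ ?_ hr ?_ ?_ (.inl j) hxR₀
    · rintro (l | l)
      · exact cut_contDiff (hu1 l)
      · exact cut_contDiff (hx1 l)
    · rintro (l | l)
      · exact cut_contDiff contDiffOn_const
      · exact cut_contDiff (hx2 l)
    · rintro (l | l) <;> exact cut_compact _
    · rintro (l | l) <;> exact cut_compact _
    · rintro (l | l) y hy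
      · simp [f, g, hzero l y hy]
      · simp [f, g, grad_zero l y hy]
    · intro y hy
      have hyO : y ∈ O := hR y (by linarith)
      have hcomm := fun l => pd2_comm ((hu l).contDiffAt (hO.mem_nhds hyO)) (1, 0) (0, 1)
      have hconst : ∀ v, pd2 v (fun _ => (0 : ℝ)) y = 0 := fun v => by simp [pd2]
      simp only [Fintype.sum_sum_type, f, g, Sum.elim_inl, Sum.elim_inr, cut_pd2 _ hy,
        ζ_one y hy, pd2_neg, hcomm, hconst]
      convert sum_gradient_add_laplacian_le fun l => hgrowth l y hyO using 3 with l
      · ring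
      · simp only [lap2]; ring
      · simp
      · simp
  simpa [f, ζ_one x hxR₀] using main.1

end CauchyRiemann

/-- **unique continuation principle.** If `u₁, …, u_m ∈ C²(O)` on an open,
connected and simply connected `O ⊆ ℝ²` satisfy `|Δu_j| ≤ C Σ_l (|u_l| + |∇u_l|)` in `O`
and all vanish on a common non-empty open subset of `O`, then they vanish identically. -/
theorem unique_continuation_principle
    (O : Set (ℝ × ℝ)) (hO : IsOpen O) (hconn : IsConnected O)
    (hsc : SimplyConnectedSpace O)
    (m : ℕ) (u : Fin m → (ℝ × ℝ) → ℝ)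
    (hu : ∀ j, ContDiffOn ℝ 2 (u j) O)
    (C : ℝ)
    (hgrowth : ∀ j, ∀ x ∈ O,
      |lap2 (u j) x| ≤ C * ∑ l, (|u l x| + gradNorm2 (u l) x))
    (V : Set (ℝ × ℝ)) (hV : IsOpen V) (hVne : V.Nonempty) (hVO : V ⊆ O)
    (hvanish : ∀ j, ∀ x ∈ V, u j x = 0) :
    ∀ j, ∀ x ∈ O, u j x = 0 := by
  set Z : Set (ℝ × ℝ) := interior {x | ∀ j, u j x = 0}
  have hVZ : V ⊆ Z := interior_maximal (fun x hx j => hvanish j x hx) hV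
  obtain ⟨x₀, hx₀⟩ := hVne
  have hOZ : O ⊆ Z := by
    refine hconn.isPreconnected.subset_of_closure_inter_subset isOpen_interior
      ⟨x₀, hVO hx₀, hVZ hx₀⟩ ?_
    rintro x ⟨hxZ, hxO⟩
    obtain ⟨ε, hε, hball⟩ := Metric.isOpen_iff.1 hO x hxO
    obtain ⟨a, haZ, hxa⟩ := Metric.mem_closure_iff.1 hxZ (ε / 4) (by positivity)
    obtain ⟨η, hη, hηball⟩ := Metric.isOpen_iff.1 isOpen_interior a haZ
    have hxR : sqDist a x < (ε / 2) ^ 2 := by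
      nlinarith [sqDist_lt_of_dist_lt hxa]
    have hdisc : IsOpen {y | sqDist a y < (ε / 2) ^ 2} :=
      isOpen_lt (contDiff_sqDist a (n := 0)).continuous continuous_const
    refine interior_maximal (fun y hy j => ?_) hdisc hxR
    refine eq_zero_of_eq_zero_on_smaller_disc hO hu hgrowth (p := a) (r := η ^ 2)
      (R := (ε / 2) ^ 2) (by positivity) (fun l z hz => ?_) (fun z hz => hball ?_) j hy
    · exact interior_subset (hηball (dist_lt_of_sqDist_lt hη hz)) l
    · have h1 := dist_lt_of_sqDist_lt (half_pos hε) hz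
      have h2 := dist_triangle z a x
      rw [dist_comm a x] at h2
      exact Metric.mem_ball.2 (by linarith)
  exact fun j x hx => interior_subset (hOZ hx) j
end
end
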